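/- Assume the Riemann Hypothesis. There is an absolute constant C > 0 such that for all sufficiently large t: -(π/24)·(log t)/(log log t)² - C·(log t · log log log t)/(log log t)³ ≤ S₁(t) ≤ (π/48)·(log t)/(log log t)² + C·(log t · log log log t)/(log log t)³. -/

import Mathlib

open Complex MeasureTheory Real

/-- The argument function `S(t) = -(1/π) ∫_{1/2}^∞ Im(ζ'/ζ)(σ+it) dσ`. -/
noncomputable def S (t : ℝ) : ℝ :=
  -(1 / π) * ∫ σ in Set.Ioi (1 / 2 : ℝ),
    (deriv riemannZeta ((σ : ℂ) + (t : ℂ) * Complex.I) /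
      riemannZeta ((σ : ℂ) + (t : ℂ) * Complex.I)).im

/-- `S₁(t) = ∫_0^t S(u) du`. -/
noncomputable def S₁ (t : ℝ) : ℝ := ∫ u in (0 : ℝ)..t, S u

/-- The fractional part on `(1, ∞)`, extended by zero. -/
noncomputable def fractTail : ℝ → ℂ := Set.indicator (Set.Ioi 1) fun t => ((Int.fract t : ℝ) : ℂ)

theorem measurable_fractTail : Measurable fractTail :=
  (measurable_ofReal.comp measurable_fract).indicator measurableSet_Ioi

theorem norm_fractTail_le (t : ℝ) : ‖fractTail t‖ ≤ 1 := by
  unfold fractTail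
  by_cases h : t ∈ Set.Ioi (1 : ℝ)
  · rw [Set.indicator_of_mem h, Complex.norm_real, Real.norm_of_nonneg (Int.fract_nonneg t)]
    exact (Int.fract_lt_one t).le
  · simp [Set.indicator_of_notMem h]

theorem mellin_fractTail (s : ℂ) :
    mellin fractTail s = ∫ t in Set.Ioi (1 : ℝ), (t : ℂ) ^ (s - 1) * ((Int.fract t : ℝ) : ℂ) := by
  have h : ∀ t : ℝ, (t : ℂ) ^ (s - 1) • fractTail t = Set.indicator (Set.Ioi 1)
      (fun t : ℝ => (t : ℂ) ^ (s - 1) * ((Int.fract t : ℝ) : ℂ)) t := by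
    intro t
    by_cases h : t ∈ Set.Ioi (1 : ℝ) <;> simp [fractTail, h]
  simp only [mellin, h]
  rw [integral_indicator measurableSet_Ioi, Measure.restrict_restrict measurableSet_Ioi,
    Set.inter_eq_left.2 (Set.Ioi_subset_Ioi zero_le_one)]

theorem norm_cpow_mul_fract_le {s : ℂ} {t : ℝ} (ht : t ∈ Set.Ioi (1 : ℝ)) :
    ‖(t : ℂ) ^ s * ((Int.fract t : ℝ) : ℂ)‖ ≤ t ^ s.re := by
  have ht0 : (0 : ℝ) < t := zero_lt_one.trans ht
  rw [norm_mul, Complex.norm_cpow_eq_rpow_re_of_pos ht0, Complex.norm_real,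
    Real.norm_of_nonneg (Int.fract_nonneg t)]
  exact mul_le_of_le_one_right (by positivity) (Int.fract_lt_one t).le

theorem norm_mellin_fractTail_le {s : ℂ} (hs : 0 < s.re) :
    ‖mellin fractTail (-s)‖ ≤ 1 / s.re := by
  rw [mellin_fractTail]
  have hi : (-s - 1).re < -1 := by simp; linarith
  refine (norm_integral_le_of_norm_le (integrableOn_Ioi_rpow_of_lt hi zero_lt_one)
    ((ae_restrict_iff' measurableSet_Ioi).2
      (.of_forall fun t ht => norm_cpow_mul_fract_le ht))).trans ?_
  rw [integral_Ioi_rpow_of_lt hi zero_lt_one]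
  simp

theorem differentiableAt_mellin_fractTail {s : ℂ} (hs : s.re < 0) :
    DifferentiableAt ℂ (mellin fractTail) s := by
  refine mellin_differentiableAt_of_isBigO_rpow (a := 0) (b := s.re - 1) ?_ ?_ hs ?_ (by linarith)
  · refine LocallyIntegrable.locallyIntegrableOn ?_ _
    exact (locallyIntegrable_const (1 : ℝ)).mono measurable_fractTail.aestronglyMeasurable
      (.of_forall fun t => by simpa using norm_fractTail_le t)
  · refine Asymptotics.IsBigO.of_bound 1 (.of_forall fun t => ?_)
    simpa using norm_fractTail_le t
  · refine Asymptotics.IsBigO.of_bound 1 ?_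
    filter_upwards [Ioo_mem_nhdsGT (zero_lt_one' ℝ)] with t ht
    have : t ∉ Set.Ioi (1 : ℝ) := by simpa using ht.2.le
    simp [fractTail, Set.indicator_of_notMem this]

theorem riemannZeta₁_eq_mul {s : ℂ} (hs : s ≠ 1) :
    riemannZeta₁ s = (s - 1) * riemannZeta s := by
  rw [riemannZeta_eq_inv_sub_mul hs, mul_inv_cancel_left₀ (sub_ne_zero.2 hs)]

theorem riemannZeta_eq_sub_mellin_fractTail {s : ℂ} (hs : 1 < s.re) :
    riemannZeta s = s / (s - 1) - s * mellin fractTail (-s) := by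
  have h := LSeries_eq_mul_integral' (fun _ => (1 : ℂ)) zero_le_one hs
    (Asymptotics.IsBigO.of_bound 1 (.of_forall fun n => by simp))
  have h2 : LSeries (fun _ => (1 : ℂ)) s = riemannZeta s := LSeries_one_eq_riemannZeta hs
  rw [h2] at h
  rw [h, mellin_fractTail]
  have hs1 : (-s).re < -1 := by simpa using hs
  have hs0 : s - 1 ≠ 0 := by
    intro h0
    rw [sub_eq_zero] at h0
    simp [h0] at hs
  have e : Set.EqOn (fun t : ℝ => (∑ k ∈ Finset.Icc 1 ⌊t⌋₊, (1 : ℂ)) * (t : ℂ) ^ (-(s + 1)))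
      (fun t : ℝ => (t : ℂ) ^ (-s) - (t : ℂ) ^ (-s - 1) * ((Int.fract t : ℝ) : ℂ)) (Set.Ioi 1) := by
    intro t ht
    have ht0 : (0 : ℝ) < t := zero_lt_one.trans ht
    have htc : (t : ℂ) ≠ 0 := by exact_mod_cast ht0.ne'
    have e1 : (t : ℂ) ^ (-s) = t * (t : ℂ) ^ (-s - 1) := by
      rw [Complex.cpow_sub _ _ htc, Complex.cpow_one]; field_simp
    have e2 : ((⌊t⌋₊ : ℕ) : ℂ) = (t : ℂ) - ((Int.fract t : ℝ) : ℂ) := by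
      rw [← Complex.ofReal_sub, Int.self_sub_fract, ← natCast_floor_eq_intCast_floor ht0.le]
      simp
    simp only [Finset.sum_const, Nat.card_Icc, add_tsub_cancel_right, nsmul_eq_mul, mul_one, e2, e1]
    rw [show -(s + 1) = -s - 1 by ring]
    ring
  rw [setIntegral_congr_fun measurableSet_Ioi e, integral_sub
    (integrableOn_Ioi_cpow_of_lt hs1 zero_lt_one), integral_Ioi_cpow_of_lt hs1 zero_lt_one]
  · have : -s + 1 ≠ 0 := by rw [← neg_ne_zero]; convert hs0 using 1; ring
    have h4 : 1 - s ≠ 0 := by rw [← neg_ne_zero]; convert hs0 using 1; ring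
    simp
    field_simp
    ring
  · refine Integrable.mono' (integrableOn_Ioi_rpow_of_lt (a := (-s - 1).re)
      (by simp; linarith) zero_lt_one)
      ?_ ((ae_restrict_iff' measurableSet_Ioi).2 (.of_forall fun t ht => norm_cpow_mul_fract_le ht))
    exact (Measurable.mul (by fun_prop) (by fun_prop)).aestronglyMeasurable

theorem riemannZeta₁_eq_mellin_fractTail {s : ℂ} (hs : 0 < s.re) :
    riemannZeta₁ s = s - s * (s - 1) * mellin fractTail (-s) := by
  have hU : IsOpen {z : ℂ | 0 < z.re} := isOpen_lt continuous_const continuous_re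
  have hV : IsOpen {z : ℂ | 1 < z.re} := isOpen_lt continuous_const continuous_re
  have hc : IsPreconnected {z : ℂ | 0 < z.re} := (convex_halfSpace_re_gt 0).isPreconnected
  have hf : AnalyticOnNhd ℂ riemannZeta₁ {z : ℂ | 0 < z.re} :=
    differentiable_riemannZeta₁.differentiableOn.analyticOnNhd hU
  have hg : AnalyticOnNhd ℂ (fun z => z - z * (z - 1) * mellin fractTail (-z))
      {z : ℂ | 0 < z.re} := by
    refine DifferentiableOn.analyticOnNhd (fun z hz => ?_) hU
    have hz' : DifferentiableAt ℂ (mellin fractTail) (-z) :=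
      differentiableAt_mellin_fractTail (by simpa using hz)
    have : DifferentiableAt ℂ (fun z => mellin fractTail (-z)) z :=
      hz'.comp z differentiableAt_id.neg
    exact (by fun_prop : DifferentiableAt ℂ
      (fun z => z - z * (z - 1) * mellin fractTail (-z)) z).differentiableWithinAt
  refine hf.eqOn_of_preconnected_of_eventuallyEq hg hc (z₀ := 2) (by simp) ?_ hs
  filter_upwards [hV.mem_nhds (by simp : (2 : ℂ) ∈ {z : ℂ | 1 < z.re})] with z hz
  have hz1 : z ≠ 1 := by rintro rfl; simp at hz
  have hs0 : z - 1 ≠ 0 := sub_ne_zero.2 hz1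
  rw [riemannZeta₁_eq_mul hz1, riemannZeta_eq_sub_mellin_fractTail hz]
  field_simp

theorem norm_riemannZeta₁_le {s : ℂ} (hs : 0 < s.re) :
    ‖riemannZeta₁ s‖ ≤ ‖s‖ + ‖s‖ * ‖s - 1‖ / s.re := by
  rw [riemannZeta₁_eq_mellin_fractTail hs]
  refine (norm_sub_le _ _).trans ?_
  rw [norm_mul, norm_mul, div_eq_mul_one_div (‖s‖ * ‖s - 1‖)]
  gcongr
  exact norm_mellin_fractTail_le hs

/-- The Dirichlet polynomial `∑_{n < M} Λ(n) n^{-z}`. -/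
noncomputable def vonMangoldtSum (M : ℕ) (z : ℂ) : ℂ :=
  ∑ n ∈ Finset.range M, (ArithmeticFunction.vonMangoldt n : ℂ) * (n : ℂ) ^ (-z)

/-- The value `∑ Λ(n) / n²`. -/
noncomputable def vonMangoldtTwo : ℝ :=
  ∑' n : ℕ, ArithmeticFunction.vonMangoldt n * (n : ℝ) ^ (-2 : ℝ)

theorem vonMangoldt_term_eq (z : ℂ) (n : ℕ) :
    LSeries.term (fun n => (ArithmeticFunction.vonMangoldt n : ℂ)) z n
      = (ArithmeticFunction.vonMangoldt n : ℂ) * (n : ℂ) ^ (-z) := by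
  rcases eq_or_ne n 0 with rfl | h
  · simp
  · rw [LSeries.term_of_ne_zero h, Complex.cpow_neg, div_eq_mul_inv]

theorem norm_vonMangoldt_mul_cpow (z : ℂ) (n : ℕ) :
    ‖(ArithmeticFunction.vonMangoldt n : ℂ) * (n : ℂ) ^ (-z)‖
      = ArithmeticFunction.vonMangoldt n * (n : ℝ) ^ (-z.re) := by
  rcases eq_or_ne n 0 with rfl | h
  · simp
  · rw [norm_mul, Complex.norm_real, Real.norm_of_nonneg ArithmeticFunction.vonMangoldt_nonneg,
      Complex.norm_natCast_cpow_of_pos (Nat.pos_of_ne_zero h), neg_re]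

theorem summable_vonMangoldt_mul_cpow {z : ℂ} (hz : 1 < z.re) :
    Summable fun n : ℕ => (ArithmeticFunction.vonMangoldt n : ℂ) * (n : ℂ) ^ (-z) := by
  have := ArithmeticFunction.LSeriesSummable_vonMangoldt hz
  exact this.congr fun n => vonMangoldt_term_eq z n

theorem summable_vonMangoldt_two :
    Summable fun n : ℕ => ArithmeticFunction.vonMangoldt n * (n : ℝ) ^ (-2 : ℝ) := by
  have := (summable_vonMangoldt_mul_cpow (z := 2) (by simp)).norm
  simpa only [norm_vonMangoldt_mul_cpow, re_ofNat] using this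

theorem vonMangoldtTwo_nonneg : 0 ≤ vonMangoldtTwo :=
  tsum_nonneg fun n => mul_nonneg ArithmeticFunction.vonMangoldt_nonneg (by positivity)

theorem norm_logDeriv_zeta_add_vonMangoldtSum_le {z : ℂ} (hz : 2 ≤ z.re) {M : ℕ} (hM : 0 < M) :
    ‖deriv riemannZeta z / riemannZeta z + vonMangoldtSum M z‖
      ≤ vonMangoldtTwo * (M : ℝ) ^ (2 - z.re) := by
  have hz1 : 1 < z.re := by linarith
  have hs := summable_vonMangoldt_mul_cpow hz1
  have h := ArithmeticFunction.LSeries_vonMangoldt_eq_deriv_riemannZeta_div hz1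
  simp only [LSeries, vonMangoldt_term_eq] at h
  have h1 : deriv riemannZeta z / riemannZeta z + vonMangoldtSum M z =
      -∑' n : ℕ, (ArithmeticFunction.vonMangoldt (n + M) : ℂ) * ((n + M : ℕ) : ℂ) ^ (-z) := by
    have e := hs.sum_add_tsum_nat_add M
    rw [h] at e
    rw [vonMangoldtSum]
    linear_combination e
  have h2 := (summable_nat_add_iff M).2 hs
  have h3 := (summable_nat_add_iff M).2 summable_vonMangoldt_two
  rw [h1, norm_neg]
  calc _ ≤ ∑' n : ℕ, ‖(ArithmeticFunction.vonMangoldt (n + M) : ℂ) * ((n + M : ℕ) : ℂ) ^ (-z)‖ :=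
        norm_tsum_le_tsum_norm h2.norm
    _ ≤ ∑' n : ℕ, (ArithmeticFunction.vonMangoldt (n + M) * ((n + M : ℕ) : ℝ) ^ (-2 : ℝ)) *
          (M : ℝ) ^ (2 - z.re) := by
        refine h2.norm.tsum_le_tsum (fun n => ?_) (h3.mul_right _)
        rw [norm_vonMangoldt_mul_cpow, mul_assoc]
        refine mul_le_mul_of_nonneg_left ?_ ArithmeticFunction.vonMangoldt_nonneg
        have hp : (0 : ℝ) < ((n + M : ℕ) : ℝ) := by exact_mod_cast (by omega)
        have e : -z.re = -2 + (2 - z.re) := by ring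
        rw [e, Real.rpow_add hp]
        refine mul_le_mul_of_nonneg_left ?_ (by positivity)
        exact Real.rpow_le_rpow_of_nonpos (by exact_mod_cast hM) (by exact_mod_cast (by omega))
          (by linarith)
    _ = (∑' n : ℕ, ArithmeticFunction.vonMangoldt (n + M) * ((n + M : ℕ) : ℝ) ^ (-2 : ℝ)) *
          (M : ℝ) ^ (2 - z.re) := tsum_mul_right
    _ ≤ _ := by
        refine mul_le_mul_of_nonneg_right ?_ (by positivity)
        rw [vonMangoldtTwo, ← summable_vonMangoldt_two.sum_add_tsum_nat_add M]
        exact le_add_of_nonneg_left (Finset.sum_nonneg fun n _ =>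
          mul_nonneg ArithmeticFunction.vonMangoldt_nonneg (by positivity))

theorem norm_logDeriv_zeta_le {z : ℂ} (hz : 2 ≤ z.re) :
    ‖deriv riemannZeta z / riemannZeta z‖ ≤ vonMangoldtTwo * 2 ^ (2 - z.re) := by
  have := norm_logDeriv_zeta_add_vonMangoldtSum_le hz (M := 2) (by norm_num)
  simpa [vonMangoldtSum, Finset.sum_range_succ] using this

theorem norm_zeta_sub_one_le {z : ℂ} (hz : 2 ≤ z.re) :
    ‖riemannZeta z - 1‖ ≤ 2 / 3 * 2 ^ (2 - z.re) := by
  have hz1 : 1 < z.re := by linarith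
  have hs : Summable fun n : ℕ => 1 / (n : ℂ) ^ z := Complex.summable_one_div_nat_cpow.2 hz1
  have hs2 : Summable fun n : ℕ => 1 / (n : ℝ) ^ 2 := Real.summable_one_div_nat_pow.2 one_lt_two
  have e := hs.sum_add_tsum_nat_add 2
  rw [← zeta_eq_tsum_one_div_nat_cpow hz1] at e
  have hz0 : z ≠ 0 := by rintro rfl; norm_num at hz
  have e2 := hs2.sum_add_tsum_nat_add 2
  rw [hasSum_zeta_two.tsum_eq] at e2
  simp [Finset.sum_range_succ, hz0] at e e2
  have h2 := (summable_nat_add_iff 2).2 hs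
  have h3 := (summable_nat_add_iff 2).2 hs2
  rw [← e, add_sub_cancel_left]
  have hpi : π ^ 2 / 6 - 1 ≤ 2 / 3 := by nlinarith [Real.pi_lt_d2, Real.pi_pos]
  calc _ = ‖∑' n : ℕ, 1 / ((n + 2 : ℕ) : ℂ) ^ z‖ := by simp
    _ ≤ ∑' n : ℕ, ‖1 / ((n + 2 : ℕ) : ℂ) ^ z‖ := norm_tsum_le_tsum_norm h2.norm
    _ ≤ ∑' n : ℕ, 1 / ((n + 2 : ℕ) : ℝ) ^ 2 * 2 ^ (2 - z.re) := by
        refine h2.norm.tsum_le_tsum (fun n => ?_) (h3.mul_right _)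
        have hp : (0 : ℝ) < ((n + 2 : ℕ) : ℝ) := by positivity
        rw [norm_div, norm_one, Complex.norm_natCast_cpow_of_pos (by omega), one_div,
          ← Real.rpow_neg hp.le, one_div, ← Real.rpow_natCast, ← Real.rpow_neg hp.le]
        have e : -z.re = -((2 : ℕ) : ℝ) + (2 - z.re) := by push_cast; ring
        rw [e, Real.rpow_add hp]
        refine mul_le_mul_of_nonneg_left ?_ (by positivity)
        exact Real.rpow_le_rpow_of_nonpos (by norm_num)
          (by push_cast; linarith [(Nat.cast_nonneg n : (0 : ℝ) ≤ n)])
          (by linarith)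
    _ = (∑' n : ℕ, 1 / ((n + 2 : ℕ) : ℝ) ^ 2) * 2 ^ (2 - z.re) := tsum_mul_right
    _ ≤ _ := by
        refine mul_le_mul_of_nonneg_right ?_ (by positivity)
        refine le_trans (le_of_eq ?_) hpi
        rw [← e2]; simp

theorem two_rpow_two_sub_le_one {x : ℝ} (hx : 2 ≤ x) : (2 : ℝ) ^ (2 - x) ≤ 1 :=
  Real.rpow_le_one_of_one_le_of_nonpos one_le_two (by linarith)

theorem norm_zeta_mem_Icc {z : ℂ} (hz : 2 ≤ z.re) :
    ‖riemannZeta z‖ ∈ Set.Icc (1 / 3 : ℝ) (5 / 3) := by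
  have h := norm_zeta_sub_one_le hz
  have h1 := two_rpow_two_sub_le_one hz
  have h2 := norm_sub_norm_le (1 : ℂ) (1 - riemannZeta z)
  have h3 := norm_add_le (1 : ℂ) (riemannZeta z - 1)
  rw [sub_sub_cancel, norm_one, norm_sub_rev] at h2
  rw [add_sub_cancel, norm_one] at h3
  constructor <;> linarith

theorem abs_log_norm_zeta_le {z : ℂ} (hz : 2 ≤ z.re) :
    |Real.log ‖riemannZeta z‖| ≤ 2 * 2 ^ (2 - z.re) := by
  have h := norm_zeta_sub_one_le hz
  have hI := norm_zeta_mem_Icc hz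
  have hp : 0 < ‖riemannZeta z‖ := by linarith [hI.1]
  have h2 := norm_sub_norm_le (1 : ℂ) (1 - riemannZeta z)
  have h3 := norm_add_le (1 : ℂ) (riemannZeta z - 1)
  rw [sub_sub_cancel, norm_one, norm_sub_rev] at h2
  rw [add_sub_cancel, norm_one] at h3
  have hpow : (0:ℝ) < 2 ^ (2 - z.re) := by positivity
  rw [abs_le]
  constructor
  · have := Real.one_sub_inv_le_log_of_pos hp
    refine le_trans ?_ this
    have h4 : ‖riemannZeta z‖⁻¹ - 1 ≤ 3 * (1 - ‖riemannZeta z‖) ∨ 1 ≤ ‖riemannZeta z‖ := by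
      by_cases h1 : 1 ≤ ‖riemannZeta z‖
      · exact Or.inr h1
      · left
        have : ‖riemannZeta z‖⁻¹ ≤ 3 := by
          rw [inv_le_comm₀ hp (by norm_num)]; linarith [hI.1]
        have e : ‖riemannZeta z‖⁻¹ - 1 = ‖riemannZeta z‖⁻¹ * (1 - ‖riemannZeta z‖) := by
          field_simp
        rw [e]
        exact mul_le_mul_of_nonneg_right this (by linarith)
    rcases h4 with h4 | h4
    · linarith
    · have : ‖riemannZeta z‖⁻¹ ≤ 1 := inv_le_one_of_one_le₀ h4
      linarith
  · have := Real.log_le_sub_one_of_pos hp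
    linarith

theorem norm_le_norm_add_mul_exp {u : ℂ} {h c : ℝ} (hh : 0 ≤ h)
    (hc : c * ‖u + h‖ ^ 2 ≤ u.re) : ‖u‖ ≤ ‖u + h‖ * Real.exp (-(h * c)) := by
  have hn : ∀ z : ℂ, ‖z‖ ^ 2 = z.re ^ 2 + z.im ^ 2 := fun z => by
    rw [← Complex.normSq_eq_norm_sq, Complex.normSq_apply]; ring
  have h1 := hn u
  have h2 := hn (u + h)
  simp at h2
  refine le_of_sq_le_sq ?_ (by positivity)
  rw [mul_pow, ← Real.exp_nat_mul]
  have h3 := Real.add_one_le_exp (((2 : ℕ) : ℝ) * (-(h * c)))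
  refine le_trans ?_ (mul_le_mul_of_nonneg_left h3 (sq_nonneg _))
  push_cast
  nlinarith [mul_le_mul_of_nonneg_left hc hh]

theorem half_log_sub_le_sum (y : ℝ) (N : ℕ) :
    Real.log (((N : ℝ) + 2) ^ 2 + y ^ 2) / 2 - Real.log (4 + y ^ 2) / 2
        - 3 / 2 * (1 - 1 / ((N : ℝ) + 1))
      ≤ ∑ k ∈ Finset.range N, ((k : ℝ) + 1) / (((k : ℝ) + 2) ^ 2 + y ^ 2) := by
  induction N with
  | zero => norm_num
  | succ k ih =>
    rw [Finset.sum_range_succ]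
    have hk : (0 : ℝ) ≤ k := Nat.cast_nonneg k
    push_cast
    set A := ((k : ℝ) + 2) ^ 2 + y ^ 2 with hA
    have hA0 : 0 < A := by positivity
    have hA1 : ((k : ℝ) + 2) ^ 2 ≤ A := by nlinarith [sq_nonneg y]
    have h1 : Real.log (((k : ℝ) + 1 + 2) ^ 2 + y ^ 2) - Real.log A ≤ (2 * k + 5) / A := by
      rw [← Real.log_div (by positivity) hA0.ne']
      refine (Real.log_le_sub_one_of_pos (by positivity)).trans (le_of_eq ?_)
      rw [eq_div_iff hA0.ne', sub_mul, div_mul_cancel₀ _ hA0.ne', hA]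
      ring
    have h2 : (3 : ℝ) / 2 / A ≤ 3 / 2 * (1 / ((k : ℝ) + 1) - 1 / ((k : ℝ) + 1 + 1)) := by
      rw [div_sub_div _ _ (by positivity) (by positivity), div_eq_mul_one_div]
      refine mul_le_mul_of_nonneg_left ?_ (by norm_num)
      rw [div_le_div_iff₀ hA0 (by positivity)]
      nlinarith
    have h3 : (2 * (k : ℝ) + 5) / A / 2 - 3 / 2 / A = ((k : ℝ) + 1) / A := by
      field_simp; ring
    linarith

theorem norm_Gamma_add_le {u : ℂ} {h : ℝ} (hu : 1 ≤ u.re) (hh : 0 ≤ h) (huh : u.re + h ≤ 2) :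
    ‖Complex.Gamma (u + h)‖ ≤
      ‖Complex.Gamma u‖ * Real.exp (h * (Real.log (4 + u.im ^ 2) / 2 + 3 / 2)) := by
  refine le_of_tendsto_of_tendsto (Complex.GammaSeq_tendsto_Gamma _).norm
    ((Complex.GammaSeq_tendsto_Gamma u).norm.mul_const _) ?_
  filter_upwards [Filter.eventually_gt_atTop 0] with n hn
  have hn0 : (0 : ℝ) < n := by exact_mod_cast hn
  simp only [Complex.GammaSeq, norm_div, norm_mul, norm_prod,
    Complex.norm_natCast_cpow_of_pos hn]
  set c : ℕ → ℝ := fun k => ((k : ℝ) + 1) / (((k : ℝ) + 2) ^ 2 + u.im ^ 2)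
  have hne : ∀ k : ℕ, ∀ v : ℂ, 0 < v.re → 0 < ‖v + k‖ := fun k v hv => by
    rw [norm_pos_iff]
    intro h0
    have := congrArg Complex.re h0
    simp at this
    linarith [(Nat.cast_nonneg k : (0 : ℝ) ≤ k)]
  have h1 : ∏ k ∈ Finset.range (n + 1), ‖u + k‖ ≤
      (∏ k ∈ Finset.range (n + 1), ‖u + h + k‖) *
        Real.exp (-(h * ∑ k ∈ Finset.range (n + 1), c k)) := by
    rw [Finset.mul_sum, ← Finset.sum_neg_distrib, Real.exp_sum, ← Finset.prod_mul_distrib]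
    refine Finset.prod_le_prod (fun _ _ => norm_nonneg _) fun k _ => ?_
    have hk : (0 : ℝ) ≤ k := Nat.cast_nonneg k
    rw [add_right_comm]
    refine norm_le_norm_add_mul_exp hh ?_
    rw [← Complex.normSq_eq_norm_sq, Complex.normSq_apply, div_mul_eq_mul_div,
      div_le_iff₀ (by positivity)]
    simp
    have hw : (u.re + k + h) * (u.re + k + h) ≤ ((k : ℝ) + 2) ^ 2 := by nlinarith
    exact mul_le_mul (by linarith) (by nlinarith) (by nlinarith) (by linarith)
  have h2 := half_log_sub_le_sum u.im (n + 1)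
  have h3 : Real.log n ≤ Real.log ((((n + 1 : ℕ) : ℝ) + 2) ^ 2 + u.im ^ 2) / 2 := by
    have : Real.log ((n : ℝ) ^ 2) ≤ Real.log ((((n + 1 : ℕ) : ℝ) + 2) ^ 2 + u.im ^ 2) := by
      refine Real.log_le_log (by positivity) ?_
      push_cast
      nlinarith [sq_nonneg u.im]
    rw [Real.log_pow] at this
    push_cast at this ⊢
    linarith
  have h4 : (0 : ℝ) ≤ 1 / (((n + 1 : ℕ) : ℝ) + 1) := by positivity
  have p1 : 0 < ∏ k ∈ Finset.range (n + 1), ‖u + h + k‖ :=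
    Finset.prod_pos fun k _ => hne k _ (by simp; linarith)
  have p2 : 0 < ∏ k ∈ Finset.range (n + 1), ‖u + k‖ :=
    Finset.prod_pos fun k _ => hne k _ (by linarith)
  rw [div_mul_eq_mul_div, div_le_div_iff₀ p1 p2, add_re, ofReal_re, Real.rpow_add hn0]
  have h5 : (n : ℝ) ^ h * Real.exp (-(h * ∑ k ∈ Finset.range (n + 1), c k)) ≤
      Real.exp (h * (Real.log (4 + u.im ^ 2) / 2 + 3 / 2)) := by
    rw [Real.rpow_def_of_pos hn0, ← Real.exp_add, Real.exp_le_exp]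
    have : Real.log n - ∑ k ∈ Finset.range (n + 1), c k ≤
        Real.log (4 + u.im ^ 2) / 2 + 3 / 2 := by linarith
    nlinarith [mul_le_mul_of_nonneg_left this hh]
  calc _ ≤ (n : ℝ) ^ u.re * (n : ℝ) ^ h * ‖(n.factorial : ℂ)‖ *
        ((∏ k ∈ Finset.range (n + 1), ‖u + h + k‖) *
        Real.exp (-(h * ∑ k ∈ Finset.range (n + 1), c k))) := by gcongr
    _ = (n : ℝ) ^ u.re * ‖(n.factorial : ℂ)‖ * ((n : ℝ) ^ h *
        Real.exp (-(h * ∑ k ∈ Finset.range (n + 1), c k))) *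
        ∏ k ∈ Finset.range (n + 1), ‖u + h + k‖ := by ring
    _ ≤ _ := by gcongr

theorem norm_riemannZeta₁_mul_Gammaℝ {z : ℂ} (h0 : 0 < z.re) (h1 : z ≠ 1) :
    ‖riemannZeta₁ z‖ * ‖Complex.Gammaℝ z‖ = ‖z - 1‖ * ‖completedRiemannZeta z‖ := by
  have hG : Complex.Gammaℝ z ≠ 0 := Complex.Gammaℝ_ne_zero_of_re_pos h0
  have hG' : ‖Complex.Gammaℝ z‖ ≠ 0 := norm_ne_zero_iff.2 hG
  have hz : z ≠ 0 := by rintro rfl; simp at h0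
  rw [riemannZeta₁_eq_mul h1, riemannZeta_def_of_ne_zero hz, norm_mul, norm_div]
  field_simp

theorem norm_mul_norm_Gammaℝ {z : ℂ} (h0 : z ≠ 0) :
    ‖z‖ * ‖Complex.Gammaℝ z‖ = 2 * π ^ (-z.re / 2) * ‖Complex.Gamma (z / 2 + 1)‖ := by
  rw [Complex.Gamma_add_one _ (by simpa using h0), Complex.Gammaℝ_def, norm_mul, norm_mul,
    Complex.norm_cpow_eq_rpow_re_of_pos Real.pi_pos]
  simp
  ring

theorem norm_completedRiemannZeta_conj {z : ℂ} (h0 : 0 < z.re) :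
    ‖completedRiemannZeta (starRingEnd ℂ z)‖ = ‖completedRiemannZeta z‖ := by
  have hG : Complex.Gammaℝ z ≠ 0 := Complex.Gammaℝ_ne_zero_of_re_pos h0
  have hG' : Complex.Gammaℝ (starRingEnd ℂ z) ≠ 0 :=
    Complex.Gammaℝ_ne_zero_of_re_pos (by simpa using h0)
  have hz : z ≠ 0 := by rintro rfl; simp at h0
  have e := congrArg norm (riemannZeta_conj z)
  have hN : ‖Complex.Gammaℝ (starRingEnd ℂ z)‖ = ‖Complex.Gammaℝ z‖ := by
    rw [Complex.Gammaℝ_def, Complex.Gammaℝ_def, norm_mul, norm_mul,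
      Complex.norm_cpow_eq_rpow_re_of_pos Real.pi_pos,
      Complex.norm_cpow_eq_rpow_re_of_pos Real.pi_pos,
      show starRingEnd ℂ z / 2 = starRingEnd ℂ (z / 2) by rw [map_div₀, map_ofNat],
      Complex.Gamma_conj]
    simp
  rw [RCLike.norm_conj, riemannZeta_def_of_ne_zero hz,
    riemannZeta_def_of_ne_zero (by simpa using hz),
    norm_div, norm_div, hN] at e
  exact (div_left_inj' (norm_ne_zero_iff.2 hG)).1 e

theorem norm_riemannZeta₁_sub_le_of_re_eq {z : ℂ} {δ : ℝ} (hδ : 0 < δ) (hδ' : δ ≤ 1 / 4)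
    (hz : z.re = 1 / 2 + δ / 2) :
    ‖riemannZeta₁ (z - δ)‖ ≤
      ‖riemannZeta₁ z‖ * Real.exp (δ / 2 * (Real.log ‖z + 1‖ + 4)) := by
  have ez : z - δ = starRingEnd ℂ (1 - z) := by
    apply Complex.ext
    · simp; linarith
    · simp
  have hr1 : 0 < (z - δ).re := by simp; linarith
  have hr2 : 0 < (1 - z).re := by simp; linarith
  have hr0 : 0 < z.re := by linarith
  have ne1 : z ≠ 1 := by rintro rfl; simp at hr2
  have ne2 : z - δ ≠ 1 := fun h => by
    rw [h] at ez; have := congrArg Complex.re ez; simp at this; linarith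
  have ne3 : z ≠ 0 := by rintro rfl; simp at hr0
  have ne4 : z - δ ≠ 0 := fun h => by rw [h] at hr1; simp at hr1
  have a1 := norm_riemannZeta₁_mul_Gammaℝ hr0 ne1
  have a2 := norm_riemannZeta₁_mul_Gammaℝ hr1 ne2
  have e1 : ‖completedRiemannZeta (z - δ)‖ = ‖completedRiemannZeta z‖ := by
    rw [ez, norm_completedRiemannZeta_conj hr2, completedRiemannZeta_one_sub]
  have e2 : ‖z - 1‖ = ‖z - δ‖ := by rw [ez, RCLike.norm_conj, norm_sub_rev]
  have e3 : ‖z - δ - 1‖ = ‖z‖ := by rw [ez, ← RCLike.norm_conj]; simp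
  rw [e1, e3] at a2
  rw [e2] at a1
  have g1 := norm_mul_norm_Gammaℝ ne3
  have g2 := norm_mul_norm_Gammaℝ ne4
  have hG : 0 < ‖z - δ‖ * ‖Complex.Gammaℝ (z - δ)‖ :=
    mul_pos (norm_pos_iff.2 ne4) (norm_pos_iff.2 (Complex.Gammaℝ_ne_zero_of_re_pos hr1))
  have key : ‖z‖ * ‖Complex.Gammaℝ z‖ ≤ ‖z - δ‖ * ‖Complex.Gammaℝ (z - δ)‖ *
      Real.exp (δ / 2 * (Real.log ‖z + 1‖ + 4)) := by
    rw [g1, g2]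
    have hg := norm_Gamma_add_le (u := (z - δ) / 2 + 1) (h := δ / 2) (by simp; linarith)
      (by linarith) (by simp; linarith)
    rw [show (z - δ) / 2 + 1 + ((δ / 2 : ℝ) : ℂ) = z / 2 + 1 by push_cast; ring] at hg
    have h1 : π ^ (-z.re / 2) ≤ π ^ (-(z - δ).re / 2) :=
      Real.rpow_le_rpow_of_exponent_le (by linarith [Real.pi_gt_three]) (by simp; linarith)
    have h2 : Real.log (4 + ((z - δ) / 2 + 1).im ^ 2) / 2 + 3 / 2 ≤ Real.log ‖z + 1‖ + 4 := by
      have hn : ‖z + 1‖ ^ 2 = (z.re + 1) ^ 2 + z.im ^ 2 := by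
        rw [← Complex.normSq_eq_norm_sq, Complex.normSq_apply]; simp; ring
      have h3 : Real.log (4 + ((z - δ) / 2 + 1).im ^ 2) ≤ Real.log (4 * ‖z + 1‖ ^ 2) := by
        refine Real.log_le_log (by positivity) ?_
        rw [hn, hz]
        simp
        nlinarith [sq_nonneg z.im]
      have hp : 0 < ‖z + 1‖ := norm_pos_iff.2 fun h => by
        have := congrArg Complex.re h; simp at this; linarith
      rw [Real.log_mul (by norm_num) (by positivity), Real.log_pow] at h3
      have h4 : Real.log 4 ≤ 3 := by
        have := Real.log_le_sub_one_of_pos (show (0 : ℝ) < 4 by norm_num); linarith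
      push_cast at h3
      linarith
    calc _ ≤ 2 * π ^ (-(z - δ).re / 2) * (‖Complex.Gamma ((z - δ) / 2 + 1)‖ *
          Real.exp (δ / 2 * (Real.log ‖z + 1‖ + 4))) := by
          refine mul_le_mul (by gcongr) (hg.trans ?_) (norm_nonneg _) (by positivity)
          gcongr
      _ = _ := by ring
  refine le_of_mul_le_mul_right ?_ hG
  calc _ = ‖z - δ‖ * (‖z‖ * ‖completedRiemannZeta z‖) := by rw [← a2]; ring
    _ = ‖riemannZeta₁ z‖ * (‖z‖ * ‖Complex.Gammaℝ z‖) := by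
        linear_combination (-‖z‖) * a1
    _ ≤ ‖riemannZeta₁ z‖ * (‖z - δ‖ * ‖Complex.Gammaℝ (z - δ)‖ *
      Real.exp (δ / 2 * (Real.log ‖z + 1‖ + 4))) := by gcongr
    _ = _ := by ring

theorem exists_log_on_ball {f : ℂ → ℂ} {c : ℂ} {R : ℝ} (hR : 0 < R)
    (hf : DifferentiableOn ℂ f (Metric.ball c R)) (hne : ∀ z ∈ Metric.ball c R, f z ≠ 0) :
    ∃ h : ℂ → ℂ, DifferentiableOn ℂ h (Metric.ball c R) ∧ h c = 0 ∧
      ∀ z ∈ Metric.ball c R, f z = f c * Complex.exp (h z) := by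
  have ho : IsOpen (Metric.ball c R) := Metric.isOpen_ball
  obtain ⟨h, h0, hd⟩ := Complex.IsExactOn.with_val_at
    (((hf.deriv ho).div hf hne).isExactOn_ball) c (0 : ℂ)
  refine ⟨h, fun z hz => (hd z hz).differentiableAt.differentiableWithinAt, h0, fun z hz => ?_⟩
  have hD : ∀ w ∈ Metric.ball c R, HasDerivAt (fun w => f w * Complex.exp (-h w)) 0 w := by
    intro w hw
    have h1 : HasDerivAt f (deriv f w) w := (hf.differentiableAt (ho.mem_nhds hw)).hasDerivAt
    refine HasDerivAt.congr_deriv (h1.mul ((hd w hw).neg.cexp)) ?_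
    have := hne w hw
    simp only [Pi.div_apply, Pi.neg_apply]
    field_simp
    ring
  have e := ho.is_const_of_deriv_eq_zero (convex_ball c R).isPreconnected
    (fun w hw => (hD w hw).differentiableAt.differentiableWithinAt)
    (fun w hw => (hD w hw).deriv) hz (Metric.mem_ball_self hR)
  simp only [h0, neg_zero, Complex.exp_zero, mul_one] at e
  rw [← e, mul_assoc, ← Complex.exp_add]
  simp

theorem borelCaratheodory_ball {h : ℂ → ℂ} {c z : ℂ} {R M : ℝ} (hR : 0 < R) (hM : 0 < M)
    (hf : DifferentiableOn ℂ h (Metric.ball c R)) (hre : ∀ w ∈ Metric.ball c R, (h w).re ≤ M)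
    (h0 : h c = 0) (hz : z ∈ Metric.ball c R) :
    ‖h z‖ ≤ 2 * M * ‖z - c‖ / (R - ‖z - c‖) := by
  have hm : ∀ w ∈ Metric.ball (0 : ℂ) R, c + w ∈ Metric.ball c R := fun w hw => by
    simpa [dist_eq_norm] using hw
  have := Complex.borelCaratheodory_zero (f := fun w => h (c + w)) (R := R) (M := M) hM
    (hf.comp (by fun_prop) hm) (fun w hw => hre _ (hm w hw)) hR (z := z - c)
    (by simpa [dist_eq_norm] using hz) (by simpa using h0)
  simpa using this

theorem norm_mul_exp_neg_le_of_norm_le {f : ℂ → ℂ} {c z : ℂ} {R M : ℝ} (hR : 0 < R) (hM : 0 < M)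
    (hf : DifferentiableOn ℂ f (Metric.ball c R)) (hne : ∀ w ∈ Metric.ball c R, f w ≠ 0)
    (hle : ∀ w ∈ Metric.ball c R, ‖f w‖ ≤ ‖f c‖ * Real.exp M) (hz : z ∈ Metric.ball c R) :
    ‖f c‖ * Real.exp (-(2 * M * ‖z - c‖ / (R - ‖z - c‖))) ≤ ‖f z‖ := by
  obtain ⟨h, hd, h0, he⟩ := exists_log_on_ball hR hf hne
  have hc : 0 < ‖f c‖ := norm_pos_iff.2 (hne c (Metric.mem_ball_self hR))
  have hb := borelCaratheodory_ball hR hM hd (fun w hw => ?_) h0 hz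
  · rw [he z hz, norm_mul, Complex.norm_exp]
    gcongr
    have := Complex.abs_re_le_norm (h z)
    linarith [neg_abs_le (h z).re]
  · have := hle w hw
    rw [he w hw, norm_mul, Complex.norm_exp] at this
    exact Real.exp_le_exp.1 (le_of_mul_le_mul_left this hc)

theorem riemannZeta₁_ne_zero (hRH : RiemannHypothesis) {z : ℂ} (hz : 1 / 2 < z.re) :
    riemannZeta₁ z ≠ 0 := by
  rcases eq_or_ne z 1 with rfl | h1
  · simp
  rw [riemannZeta₁_eq_mul h1]
  refine mul_ne_zero (sub_ne_zero.2 h1) fun h => ?_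
  have := hRH z h ?_ h1
  · linarith
  · rintro ⟨n, rfl⟩
    have hn : (0 : ℝ) ≤ n := Nat.cast_nonneg n
    simp at hz
    linarith

theorem norm_riemannZeta₁_le_exp {z : ℂ} (hz : 1 / 4 ≤ z.re) :
    ‖riemannZeta₁ z‖ ≤ Real.exp (2 * ‖z‖ + 5) := by
  have h := norm_riemannZeta₁_le (s := z) (by linarith)
  have h1 : ‖z - 1‖ ≤ ‖z‖ + 1 := (norm_sub_le _ _).trans (by simp)
  have h2 : ‖z‖ * ‖z - 1‖ / z.re ≤ ‖z‖ * (‖z‖ + 1) * 4 := by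
    rw [div_le_iff₀ (by linarith)]
    have : ‖z‖ * ‖z - 1‖ ≤ ‖z‖ * (‖z‖ + 1) := by gcongr
    have h0 : 0 ≤ ‖z‖ * (‖z‖ + 1) := by positivity
    nlinarith
  have h3 := Real.add_one_le_exp ‖z‖
  have h4 := Real.add_one_le_exp (5 : ℝ)
  have h5 : Real.exp (2 * ‖z‖ + 5) = Real.exp ‖z‖ ^ 2 * Real.exp 5 := by
    rw [← Real.exp_nat_mul, ← Real.exp_add]; norm_num
  have h6 : (‖z‖ + 1) ^ 2 ≤ Real.exp ‖z‖ ^ 2 := by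
    have := norm_nonneg z
    gcongr
  rw [h5]
  have : (‖z‖ + 1) ^ 2 * 6 ≤ Real.exp ‖z‖ ^ 2 * Real.exp 5 := by
    refine mul_le_mul h6 (by linarith) (by norm_num) (by positivity)
  nlinarith [norm_nonneg z]

theorem one_third_le_norm_riemannZeta₁ {z : ℂ} (hz : 2 ≤ z.re) : 1 / 3 ≤ ‖riemannZeta₁ z‖ := by
  have h1 : z ≠ 1 := by rintro rfl; norm_num at hz
  rw [riemannZeta₁_eq_mul h1, norm_mul]
  have h2 := (norm_zeta_mem_Icc hz).1
  have h3 : 1 ≤ ‖z - 1‖ := by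
    have := Complex.re_le_norm (z - 1)
    simp at this
    linarith
  nlinarith

theorem half_lt_re_of_mem_ball {c w : ℂ} (hc : c.re = 2) (hw : w ∈ Metric.ball c (3 / 2)) :
    1 / 2 < w.re := by
  have h1 := (Complex.abs_re_le_norm (w - c))
  rw [mem_ball_iff_norm] at hw
  have := neg_abs_le (w - c).re
  simp at this
  simp at h1
  linarith

theorem exists_exp_neg_le_norm_riemannZeta₁ (hRH : RiemannHypothesis) {η : ℝ} (hη : 0 < η) :
    ∃ K > 0, ∀ z : ℂ, 1 / 2 + η ≤ z.re → Real.exp (-(K * (‖z‖ + 1))) ≤ ‖riemannZeta₁ z‖ := by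
  refine ⟨6 + 72 / η, by positivity, fun z hz => ?_⟩
  have hzn := norm_nonneg z
  have hlog : Real.exp (-2) ≤ 1 / 3 := by
    rw [Real.exp_neg, one_div]
    exact inv_anti₀ (by norm_num) (by linarith [Real.add_one_le_exp (2 : ℝ)])
  by_cases h2 : 2 ≤ z.re
  · refine le_trans ?_ (hlog.trans (one_third_le_norm_riemannZeta₁ h2))
    rw [Real.exp_le_exp]
    have : (0 : ℝ) < 72 / η := by positivity
    nlinarith
  push Not at h2
  set c : ℂ := ⟨2, z.im⟩ with hc
  have hzc : ‖z - c‖ = 2 - z.re := by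
    have : z - c = ((z.re - 2 : ℝ) : ℂ) := by apply Complex.ext <;> simp [hc]
    rw [this, Complex.norm_real, Real.norm_of_nonpos (by linarith)]; ring
  have hcn : ‖c‖ ≤ ‖z‖ + 2 := by
    have h3 : ‖c‖ ≤ ‖z‖ + ‖z - c‖ := by
      have := norm_sub_le z (z - c); rwa [sub_sub_cancel] at this
    linarith
  have h13 := one_third_le_norm_riemannZeta₁ (z := c) (by simp [hc])
  have hmem : ∀ w ∈ Metric.ball c (3 / 2), 1 / 2 < w.re :=
    fun w hw => half_lt_re_of_mem_ball (by simp [hc]) hw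
  have key := norm_mul_exp_neg_le_of_norm_le (f := riemannZeta₁) (c := c) (z := z) (R := 3 / 2)
    (M := 2 * ‖z‖ + 14) (by norm_num) (by positivity)
    differentiable_riemannZeta₁.differentiableOn
    (fun w hw => riemannZeta₁_ne_zero hRH (hmem w hw)) (fun w hw => ?_) ?_
  · refine le_trans ?_ key
    have hle : 2 * (2 * ‖z‖ + 14) * ‖z - c‖ / (3 / 2 - ‖z - c‖) ≤ 72 / η * (‖z‖ + 1) := by
      rw [hzc, div_mul_eq_mul_div, div_le_div_iff₀ (by linarith) hη]
      have h1 : 2 * (2 * ‖z‖ + 14) * (2 - z.re) * η ≤ 2 * (2 * ‖z‖ + 14) * (3 / 2) * η := by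
        gcongr; linarith
      have h2 : 72 * (‖z‖ + 1) * η ≤ 72 * (‖z‖ + 1) * (3 / 2 - (2 - z.re)) := by
        gcongr; linarith
      nlinarith
    calc Real.exp (-((6 + 72 / η) * (‖z‖ + 1)))
        ≤ Real.exp (-2 + -(2 * (2 * ‖z‖ + 14) * ‖z - c‖ / (3 / 2 - ‖z - c‖))) := by
          rw [Real.exp_le_exp]; nlinarith
      _ = Real.exp (-2) * Real.exp (-(2 * (2 * ‖z‖ + 14) * ‖z - c‖ / (3 / 2 - ‖z - c‖))) :=
          Real.exp_add _ _
      _ ≤ _ := by gcongr; exact hlog.trans h13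
  · have hw1 := norm_riemannZeta₁_le_exp (z := w) (by linarith [hmem w hw])
    have hwn : ‖w‖ ≤ ‖c‖ + 3 / 2 := by
      have := norm_add_le c (w - c)
      rw [add_sub_cancel] at this
      rw [mem_ball_iff_norm] at hw
      linarith
    have : Real.exp (2 * ‖w‖ + 5) ≤ Real.exp (-2) * Real.exp (2 * ‖z‖ + 14) := by
      rw [← Real.exp_add, Real.exp_le_exp]; linarith
    exact hw1.trans (this.trans (by gcongr; exact hlog.trans h13))
  · rw [mem_ball_iff_norm, hzc]; linarith

theorem hasDerivAt_log_norm {f : ℝ → ℂ} {f' : ℂ} {x : ℝ} (hf : HasDerivAt f f' x)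
    (h0 : f x ≠ 0) : HasDerivAt (fun t => Real.log ‖f t‖) (f' / f x).re x := by
  have h1 := hf.norm_sq
  have hn : ‖f x‖ ^ 2 ≠ 0 := by simpa using h0
  have h2 := (h1.log hn).div_const 2
  have e : (fun t => Real.log ‖f t‖) = fun t => Real.log (‖f t‖ ^ 2) / 2 := by
    funext t
    rw [Real.log_pow]; push_cast; ring
  rw [e]
  refine h2.congr_deriv ?_
  rw [Complex.inner, ← Complex.normSq_eq_norm_sq, Complex.div_re, Complex.mul_re]
  simp
  ring

theorem norm_riemannZeta₁_sub_le (hRH : RiemannHypothesis) {z : ℂ} {δ : ℝ} (hδ : 0 < δ)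
    (hδ' : δ ≤ 1 / 4) (hz : 1 / 2 + δ / 2 ≤ z.re) :
    ‖riemannZeta₁ (z - δ)‖ ≤
      ‖riemannZeta₁ z‖ * Real.exp (δ / 2 * (Real.log ‖z + 1‖ + 4)) := by
  set a : ℝ := 1 / 2 + δ / 2 with ha
  set f : ℂ → ℂ := fun w => riemannZeta₁ (w + a - δ) / riemannZeta₁ (w + a) *
    Complex.exp (-(δ / 2 * (Complex.log (w + a + 1) + 4))) with hf
  have hne : ∀ w : ℂ, 0 ≤ w.re → riemannZeta₁ (w + a) ≠ 0 := fun w hw =>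
    riemannZeta₁_ne_zero hRH (by simp; linarith)
  have hnorm : ∀ w : ℂ, ‖f w‖ = ‖riemannZeta₁ (w + a - δ)‖ / ‖riemannZeta₁ (w + a)‖ *
      Real.exp (-(δ / 2 * (Real.log ‖w + a + 1‖ + 4))) := by
    intro w
    rw [hf, norm_mul, norm_div, Complex.norm_exp]
    congr 2
    have : (-((δ : ℂ) / 2 * (Complex.log (w + a + 1) + 4))) =
        ((-(δ / 2) : ℝ) : ℂ) * (Complex.log (w + a + 1) + 4) := by push_cast; ring
    rw [this, Complex.re_ofReal_mul, Complex.add_re, Complex.log_re]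
    simp
  have hexp1 : ∀ w : ℂ, 0 ≤ w.re → Real.exp (-(δ / 2 * (Real.log ‖w + a + 1‖ + 4))) ≤ 1 := by
    intro w hw
    rw [Real.exp_le_one_iff, neg_nonpos]
    have : 0 ≤ Real.log ‖w + a + 1‖ := by
      refine Real.log_nonneg (le_trans ?_ (Complex.re_le_norm _))
      simp; linarith
    positivity
  have hd : DiffContOnCl ℂ f {w | 0 < w.re} := by
    refine DifferentiableOn.diffContOnCl fun w hw => DifferentiableAt.differentiableWithinAt ?_
    rw [Complex.closure_setOfPred_lt_re] at hw
    have hw' : 0 ≤ w.re := hw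
    have h1 : w + a + 1 ∈ Complex.slitPlane := Or.inl (by simp; linarith)
    have hH := differentiable_riemannZeta₁
    have := hne w hw'
    refine DifferentiableAt.mul (DifferentiableAt.div ?_ ?_ this) (DifferentiableAt.cexp ?_)
    · exact (hH _).comp w (by fun_prop)
    · exact (hH _).comp w (by fun_prop)
    · have h2 : DifferentiableAt ℂ (fun w : ℂ => Complex.log (w + a + 1)) w :=
        DifferentiableAt.clog (by fun_prop) h1
      fun_prop
  obtain ⟨K, hK, hKle⟩ := exists_exp_neg_le_norm_riemannZeta₁ hRH (η := δ / 2) (by positivity)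
  have key : ∀ w : ℂ, 0 ≤ w.re → ‖f w‖ ≤ 1 := by
    intro w hw
    refine PhragmenLindelof.right_half_plane_of_bounded_on_real hd ?_ ?_ ?_ hw
    · refine ⟨1, one_lt_two, 11 + 3 * K, Asymptotics.IsBigO.of_bound 1 ?_⟩
      have h1 : ∀ᶠ w : ℂ in Bornology.cobounded ℂ ⊓ Filter.principal {z : ℂ | 0 < z.re},
          1 ≤ ‖w‖ := Filter.Eventually.filter_mono inf_le_left
            (tendsto_norm_cobounded_atTop.eventually (Filter.eventually_ge_atTop 1))
      have h2 : ∀ᶠ w : ℂ in Bornology.cobounded ℂ ⊓ Filter.principal {z : ℂ | 0 < z.re},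
          0 < w.re := Filter.Eventually.filter_mono inf_le_right (Filter.mem_principal_self _)
      filter_upwards [h1, h2] with w hw1 hw2
      rw [hnorm, Real.norm_of_nonneg (by positivity), one_mul, Real.rpow_one]
      have e1 := norm_riemannZeta₁_le_exp (z := w + a - δ) (by simp; linarith)
      have e2 := hKle (w + a) (by simp; linarith)
      have n1 : ‖w + a‖ ≤ ‖w‖ + 1 := by
        refine (norm_add_le _ _).trans ?_
        rw [Complex.norm_real, Real.norm_of_nonneg (by positivity)]; linarith
      have n2 : ‖w + a - δ‖ ≤ ‖w‖ + 2 := by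
        refine (norm_sub_le _ _).trans ?_
        rw [Complex.norm_real, Real.norm_of_nonneg hδ.le]; linarith
      have e3 : ‖riemannZeta₁ (w + a - δ)‖ / ‖riemannZeta₁ (w + a)‖ ≤
          Real.exp (2 * ‖w + a - δ‖ + 5) / Real.exp (-(K * (‖w + a‖ + 1))) := by gcongr
      rw [← Real.exp_sub] at e3
      refine (mul_le_mul e3 (hexp1 w hw2.le) (by positivity) (by positivity)).trans ?_
      rw [mul_one, Real.exp_le_exp]
      nlinarith [mul_le_mul_of_nonneg_left n1 hK.le]
    · refine ⟨5, Filter.eventually_map.2 ?_⟩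
      filter_upwards [Filter.eventually_ge_atTop 2] with x hx
      rw [hnorm]
      have hx0 : 0 ≤ (x : ℂ).re := by simp; linarith
      have ne1 : (x : ℂ) + a ≠ 1 := fun h => by
        have := congrArg Complex.re h; simp at this; linarith
      have ne2 : (x : ℂ) + a - δ ≠ 1 := fun h => by
        have := congrArg Complex.re h; simp at this; linarith
      have z1 := (norm_zeta_mem_Icc (z := x + a) (by simp; linarith)).1
      have z2 := (norm_zeta_mem_Icc (z := x + a - δ) (by simp; linarith)).2
      have hle : ‖riemannZeta₁ (x + a - δ)‖ / ‖riemannZeta₁ (x + a)‖ ≤ 5 := by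
        rw [div_le_iff₀ (norm_pos_iff.2 (hne _ hx0)), riemannZeta₁_eq_mul ne1,
          riemannZeta₁_eq_mul ne2, norm_mul, norm_mul]
        have n1 : ‖(x : ℂ) + a - 1‖ = x + a - 1 := by
          rw [← Complex.ofReal_add, ← Complex.ofReal_one, ← Complex.ofReal_sub, Complex.norm_real,
            Real.norm_of_nonneg (by linarith)]
        have n2 : ‖(x : ℂ) + a - δ - 1‖ = x + a - δ - 1 := by
          rw [← Complex.ofReal_add, ← Complex.ofReal_one, ← Complex.ofReal_sub,
            ← Complex.ofReal_sub, Complex.norm_real, Real.norm_of_nonneg (by linarith)]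
        rw [n1, n2]
        calc _ ≤ (x + a - 1) * (5 / 3) := by
              refine mul_le_mul (by linarith) z2 (norm_nonneg _) (by linarith)
          _ = 5 * ((x + a - 1) * (1 / 3)) := by ring
          _ ≤ _ := by gcongr; linarith
      calc _ ≤ (5 : ℝ) * 1 := mul_le_mul hle (hexp1 _ hx0) (by positivity) (by norm_num)
        _ = 5 := mul_one _
    · intro x
      have hre : (x * Complex.I + a : ℂ).re = 1 / 2 + δ / 2 := by simp [ha]
      have := norm_riemannZeta₁_sub_le_of_re_eq hδ hδ' hre
      rw [hnorm, Real.exp_neg, ← div_eq_mul_inv, div_div, div_le_one]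
      · exact this
      · exact mul_pos (norm_pos_iff.2 (hne _ (by simp))) (Real.exp_pos _)
  have := key (z - a) (by simp; linarith)
  have hz0 := hne (z - a) (by simp; linarith)
  rw [hnorm, Real.exp_neg, ← div_eq_mul_inv, div_div, div_le_one
    (mul_pos (norm_pos_iff.2 hz0) (Real.exp_pos _))] at this
  simpa using this

/-- The logarithmic derivative of `(z - 1) ζ(z)` plus a correction making the real part
nonnegative to the right of the critical line. -/
noncomputable def shiftedLogDeriv (z : ℂ) : ℂ :=
  deriv riemannZeta₁ z / riemannZeta₁ z + (1 / 2 * Complex.log (z + 1) + 2)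

theorem shiftedLogDeriv_re_nonneg (hRH : RiemannHypothesis) {z : ℂ} (hz : 1 / 2 < z.re) :
    0 ≤ (shiftedLogDeriv z).re := by
  have hd : HasDerivAt (fun δ : ℝ => riemannZeta₁ (z - δ)) (deriv riemannZeta₁ z * (-1)) 0 := by
    have h1 : HasDerivAt riemannZeta₁ (deriv riemannZeta₁ z) (z - ((0 : ℝ) : ℂ)) := by
      simpa using (differentiable_riemannZeta₁ z).hasDerivAt
    have h2 : HasDerivAt (fun δ : ℝ => z - (δ : ℂ)) (-1) 0 := by
      simpa using (Complex.ofRealCLM.hasDerivAt (x := 0)).const_sub z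
    exact HasDerivAt.comp (h := fun δ : ℝ => z - (δ : ℂ)) (h₂ := riemannZeta₁) (0 : ℝ) h1 h2
  have h0 := riemannZeta₁_ne_zero hRH hz
  have hl := hasDerivAt_log_norm hd (by simpa using h0)
  have hlim := hl.tendsto_slope_zero_right
  have hle : (deriv riemannZeta₁ z * (-1) / riemannZeta₁ (z - ((0 : ℝ) : ℂ))).re ≤
      1 / 2 * (Real.log ‖z + 1‖ + 4) := by
    refine le_of_tendsto hlim ?_
    have hm : 0 < min (1 / 4) (z.re - 1 / 2) := lt_min (by norm_num) (by linarith)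
    filter_upwards [Ioo_mem_nhdsGT hm] with δ hδ
    have hδ1 : δ < 1 / 4 := hδ.2.trans_le (min_le_left _ _)
    have hδ2 : δ < z.re - 1 / 2 := hδ.2.trans_le (min_le_right _ _)
    have h := norm_riemannZeta₁_sub_le hRH hδ.1 hδ1.le (z := z) (by linarith)
    have hδ0 := hδ.1
    simp only [zero_add, Complex.ofReal_zero, sub_zero, smul_eq_mul]
    rw [inv_mul_le_iff₀ hδ0]
    have h3 : riemannZeta₁ (z - δ) ≠ 0 := riemannZeta₁_ne_zero hRH (by simp; linarith)
    have := Real.log_le_log (norm_pos_iff.2 h3) h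
    rw [Real.log_mul (norm_ne_zero_iff.2 h0) (Real.exp_pos _).ne', Real.log_exp] at this
    linarith
  simp only [Complex.ofReal_zero, sub_zero, mul_neg, mul_one, neg_div, neg_re] at hle
  rw [shiftedLogDeriv, add_re, add_re,
    show (1 / 2 : ℂ) = ((1 / 2 : ℝ) : ℂ) by push_cast; rfl, Complex.re_ofReal_mul, Complex.log_re]
  simp
  simp at hle
  linarith

theorem logDeriv_riemannZeta₁_eq {z : ℂ} (h1 : z ≠ 1) (h0 : riemannZeta z ≠ 0) :
    deriv riemannZeta₁ z / riemannZeta₁ z = deriv riemannZeta z / riemannZeta z + 1 / (z - 1) := by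
  have hs : z - 1 ≠ 0 := sub_ne_zero.2 h1
  have hd : HasDerivAt riemannZeta₁ (1 * riemannZeta z + (z - 1) * deriv riemannZeta z) z := by
    have h2 : HasDerivAt (fun w => (w - 1) * riemannZeta w)
        (1 * riemannZeta z + (z - 1) * deriv riemannZeta z) z :=
      ((hasDerivAt_id z).sub_const 1).mul (differentiableAt_riemannZeta h1).hasDerivAt
    refine h2.congr_of_eventuallyEq ?_
    filter_upwards [isOpen_ne.mem_nhds h1] with w hw using riemannZeta₁_eq_mul hw
  rw [hd.deriv, riemannZeta₁_eq_mul h1]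
  field_simp
  ring

theorem differentiableAt_shiftedLogDeriv (hRH : RiemannHypothesis) {z : ℂ} (hz : 1 / 2 < z.re) :
    DifferentiableAt ℂ shiftedLogDeriv z := by
  have hH := differentiable_riemannZeta₁
  have hH' : DifferentiableAt ℂ (deriv riemannZeta₁) z :=
    (hH.contDiff (n := 2)).differentiable_deriv_two z
  have h1 : DifferentiableAt ℂ (fun w : ℂ => Complex.log (w + 1)) z :=
    DifferentiableAt.clog (by fun_prop) (Or.inl (by simp; linarith))
  have h0 := riemannZeta₁_ne_zero hRH hz
  have h2 := hH'.fun_div (hH z) h0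
  have : shiftedLogDeriv = fun z => deriv riemannZeta₁ z / riemannZeta₁ z +
    (1 / 2 * Complex.log (z + 1) + 2) := rfl
  rw [this]
  fun_prop

theorem norm_sub_le_of_re_nonneg {f : ℂ → ℂ} {c z : ℂ} {R M : ℝ} (hR : 0 < R) (hM : 0 < M)
    (hf : DifferentiableOn ℂ f (Metric.ball c R)) (hre : ∀ w ∈ Metric.ball c R, 0 ≤ (f w).re)
    (hc : (f c).re ≤ M) (hz : z ∈ Metric.ball c R) :
    ‖f z - f c‖ ≤ 2 * M * ‖z - c‖ / (R - ‖z - c‖) := by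
  have := borelCaratheodory_ball (h := fun w => f c - f w) hR hM (hf.const_sub _)
    (fun w hw => by have := hre w hw; simp; linarith) (sub_self _) hz
  rwa [norm_sub_rev] at this

theorem norm_log_add_one_le {z : ℂ} (hz : 0 ≤ z.re) : ‖Complex.log (z + 1)‖ ≤ ‖z‖ + 4 := by
  have h1 : 1 ≤ ‖z + 1‖ := le_trans (by simp; linarith) (Complex.re_le_norm (z + 1))
  have h2 : ‖z + 1‖ ≤ ‖z‖ + 1 := (norm_add_le _ _).trans (by simp)
  have h3 := Real.log_le_sub_one_of_pos (zero_lt_one.trans_le h1)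
  have h4 := Complex.abs_arg_le_pi (z + 1)
  have h5 := Complex.norm_le_abs_re_add_abs_im (Complex.log (z + 1))
  rw [Complex.log_re, Complex.log_im, abs_of_nonneg (Real.log_nonneg h1)] at h5
  linarith [Real.pi_lt_d2]

theorem norm_shiftedLogDeriv_le_of_two_le {z : ℂ} (hz : 2 ≤ z.re) :
    ‖shiftedLogDeriv z‖ ≤ vonMangoldtTwo + ‖z‖ + 5 := by
  have h1 : z ≠ 1 := by rintro rfl; norm_num at hz
  have hr : 1 ≤ ‖z - 1‖ := le_trans (by simp; linarith) (Complex.re_le_norm (z - 1))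
  have h0 : riemannZeta z ≠ 0 := riemannZeta_ne_zero_of_one_lt_re (by linarith)
  have e1 := norm_logDeriv_zeta_le hz
  have e2 := two_rpow_two_sub_le_one hz
  have e3 : vonMangoldtTwo * 2 ^ (2 - z.re) ≤ vonMangoldtTwo :=
    mul_le_of_le_one_right vonMangoldtTwo_nonneg e2
  have e4 : ‖1 / (z - 1)‖ ≤ 1 := by
    rw [norm_div, norm_one, div_le_one (by linarith)]; exact hr
  have e5 := norm_log_add_one_le (z := z) (by linarith)
  have e6 : ‖1 / 2 * Complex.log (z + 1) + 2‖ ≤ 1 / 2 * ‖Complex.log (z + 1)‖ + 2 := by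
    refine (norm_add_le _ _).trans ?_
    rw [norm_mul]; norm_num
  rw [shiftedLogDeriv, logDeriv_riemannZeta₁_eq h1 h0]
  refine (norm_add_le _ _).trans ?_
  have e7 := norm_add_le (deriv riemannZeta z / riemannZeta z) (1 / (z - 1))
  linarith [norm_nonneg z]

theorem exists_norm_shiftedLogDeriv_le (hRH : RiemannHypothesis) {a : ℝ} (ha : 1 / 2 < a) :
    ∃ K > 0, ∀ z : ℂ, a ≤ z.re → ‖shiftedLogDeriv z‖ ≤ K * (‖z‖ + 1) := by
  have hV := vonMangoldtTwo_nonneg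
  set A := vonMangoldtTwo + 8 with hA
  have hη : 0 < a - 1 / 2 := by linarith
  refine ⟨A * (1 + 3 / (a - 1 / 2)), by positivity, fun z hz => ?_⟩
  have hzn := norm_nonneg z
  have hfrac : 0 < 3 / (a - 1 / 2) := by positivity
  by_cases h2 : 2 ≤ z.re
  · refine (norm_shiftedLogDeriv_le_of_two_le h2).trans ?_
    have : A * 1 * (‖z‖ + 1) ≤ A * (1 + 3 / (a - 1 / 2)) * (‖z‖ + 1) := by gcongr; linarith
    nlinarith
  push Not at h2
  set c : ℂ := ⟨2, z.im⟩ with hc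
  have hzc : ‖z - c‖ = 2 - z.re := by
    have : z - c = ((z.re - 2 : ℝ) : ℂ) := by apply Complex.ext <;> simp [hc]
    rw [this, Complex.norm_real, Real.norm_of_nonpos (by linarith)]; ring
  have hcn : ‖c‖ ≤ ‖z‖ + 2 := by
    have h3 : ‖c‖ ≤ ‖z‖ + ‖z - c‖ := by
      have := norm_sub_le z (z - c); rwa [sub_sub_cancel] at this
    linarith
  have hgc := norm_shiftedLogDeriv_le_of_two_le (z := c) (by simp [hc])
  have hgc' : ‖shiftedLogDeriv c‖ ≤ A * (‖z‖ + 1) := by nlinarith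
  have hmem : ∀ w ∈ Metric.ball c (3 / 2), 1 / 2 < w.re :=
    fun w hw => half_lt_re_of_mem_ball (by simp [hc]) hw
  have key := norm_sub_le_of_re_nonneg (f := shiftedLogDeriv) (c := c) (z := z) (R := 3 / 2)
    (M := A * (‖z‖ + 1)) (by norm_num) (by positivity)
    (fun w hw => (differentiableAt_shiftedLogDeriv hRH (hmem w hw)).differentiableWithinAt)
    (fun w hw => shiftedLogDeriv_re_nonneg hRH (hmem w hw))
    ((Complex.re_le_norm _).trans hgc') (by rw [mem_ball_iff_norm, hzc]; linarith)
  have hle : 2 * (A * (‖z‖ + 1)) * ‖z - c‖ / (3 / 2 - ‖z - c‖) ≤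
      A * (3 / (a - 1 / 2)) * (‖z‖ + 1) := by
    rw [hzc]
    calc _ ≤ 2 * (A * (‖z‖ + 1)) * (3 / 2) / (a - 1 / 2) := by
          refine div_le_div₀ (by positivity) ?_ hη (by linarith)
          refine mul_le_mul_of_nonneg_left (by linarith) (by positivity)
      _ = _ := by ring
  have := norm_add_le (shiftedLogDeriv z - shiftedLogDeriv c) (shiftedLogDeriv c)
  rw [sub_add_cancel] at this
  linarith

theorem re_shiftedLogDeriv_le (hRH : RiemannHypothesis) {s s₀ t : ℝ} (hs : 0 < s) (hss : s ≤ s₀) :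
    (shiftedLogDeriv (1 / 2 + s + t * Complex.I)).re ≤
      2 * (s₀ / s) * (shiftedLogDeriv (1 / 2 + s₀ + t * Complex.I)).re := by
  set c : ℂ := 1 / 2 + s₀ + t * Complex.I with hc
  set z : ℂ := 1 / 2 + s + t * Complex.I with hz
  have hs0 : 0 < s₀ := hs.trans_le hss
  have hcre : c.re = 1 / 2 + s₀ := by simp [hc]
  have hmem : ∀ w ∈ Metric.ball c s₀, 1 / 2 < w.re := by
    intro w hw
    rw [mem_ball_iff_norm] at hw
    have h1 := Complex.abs_re_le_norm (w - c)
    have := neg_abs_le (w - c).re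
    rw [Complex.sub_re, hcre] at this h1
    linarith
  have hzc : ‖z - c‖ = s₀ - s := by
    have : z - c = ((s - s₀ : ℝ) : ℂ) := by rw [hz, hc]; push_cast; ring
    rw [this, Complex.norm_real, Real.norm_of_nonpos (by linarith)]; ring
  have hF := shiftedLogDeriv_re_nonneg hRH (z := c) (by rw [hcre]; linarith)
  have hε : ∀ ε > 0, (shiftedLogDeriv z).re - (shiftedLogDeriv c).re ≤
      2 * ((shiftedLogDeriv c).re + ε) * (s₀ - s) / s := by
    intro ε hε
    have key := norm_sub_le_of_re_nonneg (f := shiftedLogDeriv) (c := c) (z := z) (R := s₀)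
      (M := (shiftedLogDeriv c).re + ε) hs0 (by positivity)
      (fun w hw => (differentiableAt_shiftedLogDeriv hRH (hmem w hw)).differentiableWithinAt)
      (fun w hw => shiftedLogDeriv_re_nonneg hRH (hmem w hw))
      (by linarith) (by rw [mem_ball_iff_norm, hzc]; linarith)
    rw [hzc, sub_sub_cancel] at key
    have := (Complex.re_le_norm _).trans key
    rwa [Complex.sub_re] at this
  have h0 : (shiftedLogDeriv z).re - (shiftedLogDeriv c).re ≤
      2 * (shiftedLogDeriv c).re * (s₀ - s) / s := by
    refine le_of_forall_pos_le_add fun ε he => ?_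
    have h := hε (ε * s / (2 * (s₀ - s) + 1)) (by have : 0 ≤ s₀ - s := by linarith
                                                  positivity)
    refine h.trans ?_
    rw [← sub_nonneg]
    have h1 : 0 ≤ s₀ - s := by linarith
    have e : 2 * (shiftedLogDeriv c).re * (s₀ - s) / s + ε - 2 * ((shiftedLogDeriv c).re +
        ε * s / (2 * (s₀ - s) + 1)) * (s₀ - s) / s = ε / (2 * (s₀ - s) + 1) := by
      field_simp
      ring
    rw [e]
    positivity
  have e2 : 2 * (shiftedLogDeriv c).re * (s₀ - s) / s =
      2 * (s₀ / s) * (shiftedLogDeriv c).re - 2 * (shiftedLogDeriv c).re := by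
    field_simp
  linarith

theorem neg_one_le_re_of_phragmenLindelof {f : ℂ → ℂ} {a K K' : ℝ} (ha0 : 0 < a) (ha1 : a < 1)
    (hK : 0 ≤ K) (hd : ∀ z, a ≤ z.re → DifferentiableAt ℂ f z)
    (hgrow : ∀ z : ℂ, a ≤ z.re → 3 ≤ ‖z‖ → ‖f z‖ ≤ K * (‖z‖ + 1))
    (hreal : ∀ᶠ σ : ℝ in Filter.atTop, -K' ≤ (f σ).re)
    (hline : ∀ z : ℂ, z.re = a → -1 ≤ (f z).re) {z : ℂ} (hz : a ≤ z.re) : -1 ≤ (f z).re := by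
  have key : ∀ w : ℂ, 0 ≤ w.re → ‖Complex.exp (-f (w + a))‖ ≤ Real.exp 1 := by
    intro w hw
    refine PhragmenLindelof.right_half_plane_of_bounded_on_real
      (f := fun w => Complex.exp (-f (w + a))) ?_ ?_ ?_ ?_ hw
    · refine DifferentiableOn.diffContOnCl fun w hw => DifferentiableAt.differentiableWithinAt ?_
      rw [Complex.closure_setOfPred_lt_re] at hw
      have hw' : 0 ≤ w.re := hw
      have h1 : DifferentiableAt ℂ (fun w : ℂ => f (w + a)) w :=
        (hd (w + a) (by simp; linarith)).comp w (by fun_prop)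
      exact h1.neg.cexp
    · refine ⟨1, one_lt_two, 3 * K, Asymptotics.IsBigO.of_bound 1 ?_⟩
      have h1 : ∀ᶠ w : ℂ in Bornology.cobounded ℂ ⊓ Filter.principal {z : ℂ | 0 < z.re},
          4 ≤ ‖w‖ := Filter.Eventually.filter_mono inf_le_left
            (tendsto_norm_cobounded_atTop.eventually (Filter.eventually_ge_atTop 4))
      have h2 : ∀ᶠ w : ℂ in Bornology.cobounded ℂ ⊓ Filter.principal {z : ℂ | 0 < z.re},
          0 < w.re := Filter.Eventually.filter_mono inf_le_right (Filter.mem_principal_self _)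
      filter_upwards [h1, h2] with w hw1 hw2
      have n0 : ‖(a : ℂ)‖ = a := by rw [Complex.norm_real, Real.norm_of_nonneg ha0.le]
      have n1 : ‖w + a‖ ≤ ‖w‖ + 1 := (norm_add_le _ _).trans (by rw [n0]; linarith)
      have n2 : ‖w‖ - 1 ≤ ‖w + a‖ := by
        have := norm_sub_le (w + a) a
        rw [add_sub_cancel_right, n0] at this
        linarith
      have hg := hgrow (w + a) (by simp; linarith) (by linarith)
      rw [Complex.norm_exp, Real.norm_of_nonneg (Real.exp_pos _).le, one_mul, Real.rpow_one,
        Real.exp_le_exp, neg_re]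
      have := Complex.abs_re_le_norm (f (w + a))
      have := neg_abs_le (f (w + a)).re
      nlinarith [mul_le_mul_of_nonneg_left n1 hK]
    · refine ⟨Real.exp K', Filter.eventually_map.2 ?_⟩
      have ht : Filter.Tendsto (fun x : ℝ => x + a) Filter.atTop Filter.atTop :=
        Filter.tendsto_atTop_add_const_right _ _ Filter.tendsto_id
      filter_upwards [ht.eventually hreal] with x hx
      rw [Complex.norm_exp, Real.exp_le_exp, neg_re]
      rw [Complex.ofReal_add] at hx
      linarith
    · intro x
      rw [Complex.norm_exp, Real.exp_le_exp, neg_re]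
      linarith [hline (x * Complex.I + a) (by simp)]
  have := key (z - a) (by simp; linarith)
  rw [Complex.norm_exp, Real.exp_le_exp, neg_re, sub_add_cancel] at this
  linarith

/-- The entire function `(1 - x ^ (1 - z)) / (z - 1)`. -/
noncomputable def truncatedPole (x : ℝ) (z : ℂ) : ℂ :=
  -dslope (fun z : ℂ => (x : ℂ) ^ (1 - z)) 1 z

theorem truncatedPole_of_ne {x : ℝ} {z : ℂ} (hz : z ≠ 1) :
    truncatedPole x z = (1 - (x : ℂ) ^ (1 - z)) / (z - 1) := by
  rw [truncatedPole, dslope_of_ne _ hz, slope_def_field]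
  simp
  rw [← neg_div, neg_sub]

theorem differentiable_truncatedPole {x : ℝ} (hx : 0 < x) : Differentiable ℂ (truncatedPole x) := by
  have h : Differentiable ℂ (fun z : ℂ => (x : ℂ) ^ (1 - z)) := fun z =>
    DifferentiableAt.const_cpow (by fun_prop) (Or.inl (by exact_mod_cast hx.ne'))
  have := (Complex.differentiableOn_dslope (c := 1) Filter.univ_mem).2 h.differentiableOn
  exact (differentiableOn_univ.1 this).neg

theorem truncatedPole_conj {x : ℝ} (hx : 0 < x) {z : ℂ} (hz : z ≠ 1) :
    truncatedPole x (starRingEnd ℂ z) = starRingEnd ℂ (truncatedPole x z) := by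
  have hz' : starRingEnd ℂ z ≠ 1 := fun h => hz (by
    have := congrArg (starRingEnd ℂ) h; simpa using this)
  have harg : (x : ℂ).arg ≠ π := by
    rw [Complex.arg_ofReal_of_nonneg hx.le]; exact Real.pi_pos.ne
  have e : (x : ℂ) ^ (1 - starRingEnd ℂ z) = starRingEnd ℂ ((x : ℂ) ^ (1 - z)) := by
    have h := Complex.cpow_conj (x : ℂ) (1 - z) harg
    rwa [Complex.conj_ofReal, map_sub, map_one] at h
  rw [truncatedPole_of_ne hz, truncatedPole_of_ne hz', e, map_div₀, map_sub, map_sub, map_one]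

theorem vonMangoldtSum_conj (M : ℕ) (z : ℂ) :
    vonMangoldtSum M (starRingEnd ℂ z) = starRingEnd ℂ (vonMangoldtSum M z) := by
  have harg : ∀ n : ℕ, (n : ℂ).arg ≠ π := fun n => by
    rw [Complex.natCast_arg]; exact Real.pi_pos.ne
  simp only [vonMangoldtSum, map_sum, map_mul, Complex.conj_ofReal]
  refine Finset.sum_congr rfl fun n _ => ?_
  have h := Complex.cpow_conj (n : ℂ) (-z) (harg n)
  rw [Complex.conj_natCast, map_neg] at h
  rw [h]

theorem differentiable_vonMangoldtSum (M : ℕ) : Differentiable ℂ (vonMangoldtSum M) := by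
  unfold vonMangoldtSum
  refine Differentiable.fun_sum fun n _ => ?_
  rcases eq_or_ne n 0 with rfl | h
  · simp
  · exact (Differentiable.const_cpow (by fun_prop) (Or.inl (by exact_mod_cast h))).const_mul _

theorem norm_truncatedPole_le {x : ℝ} (hx : 0 < x) {z : ℂ} (hz : 1 ≤ ‖z - 1‖) :
    ‖truncatedPole x z‖ ≤ 1 + x ^ (1 - z.re) := by
  have hz1 : z ≠ 1 := by rintro rfl; norm_num at hz
  rw [truncatedPole_of_ne hz1, norm_div]
  refine (div_le_self (norm_nonneg _) hz).trans ((norm_sub_le _ _).trans ?_)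
  rw [Complex.norm_cpow_eq_rpow_re_of_pos hx]
  simp

theorem norm_vonMangoldtSum_le (M : ℕ) (z : ℂ) :
    ‖vonMangoldtSum M z‖ ≤
      ∑ n ∈ Finset.range M, ArithmeticFunction.vonMangoldt n * (n : ℝ) ^ (-z.re) := by
  refine (norm_sum_le _ _).trans (le_of_eq ?_)
  exact Finset.sum_congr rfl fun n _ => norm_vonMangoldt_mul_cpow z n

theorem vonMangoldt_mul_rpow_le {n : ℕ} {b c : ℝ} (h : b ≤ c) :
    ArithmeticFunction.vonMangoldt n * (n : ℝ) ^ b ≤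
      ArithmeticFunction.vonMangoldt n * (n : ℝ) ^ c := by
  rcases eq_or_ne n 0 with rfl | hn
  · simp
  refine mul_le_mul_of_nonneg_left ?_ ArithmeticFunction.vonMangoldt_nonneg
  exact Real.rpow_le_rpow_of_exponent_le (by exact_mod_cast Nat.one_le_iff_ne_zero.2 hn) h

theorem rpow_mul_norm_vonMangoldtSum_le {M : ℕ} {x b c : ℝ} (hx : 0 < x) {z : ℂ}
    (hM : ∀ n < M, (n : ℝ) ≤ x) (hc : 0 ≤ c) (hz : b - c ≤ z.re) :
    x ^ (-c) * ‖vonMangoldtSum M z‖ ≤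
      ∑ n ∈ Finset.range M, ArithmeticFunction.vonMangoldt n * (n : ℝ) ^ (-b) := by
  refine (mul_le_mul_of_nonneg_left (norm_vonMangoldtSum_le M z) (by positivity)).trans ?_
  rw [Finset.mul_sum]
  refine Finset.sum_le_sum fun n hn => ?_
  rcases eq_or_ne n 0 with rfl | h0
  · simp
  have hn0 : (0 : ℝ) < n := by exact_mod_cast Nat.pos_of_ne_zero h0
  have hnx := hM n (Finset.mem_range.1 hn)
  calc _ ≤ x ^ (-c) * (ArithmeticFunction.vonMangoldt n * (n : ℝ) ^ (-b + c)) :=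
        mul_le_mul_of_nonneg_left (vonMangoldt_mul_rpow_le (by linarith)) (by positivity)
    _ = ArithmeticFunction.vonMangoldt n * (n : ℝ) ^ (-b) * (x ^ (-c) * (n : ℝ) ^ c) := by
        rw [Real.rpow_add hn0]; ring
    _ ≤ ArithmeticFunction.vonMangoldt n * (n : ℝ) ^ (-b) * (x ^ (-c) * x ^ c) := by
        have := @ArithmeticFunction.vonMangoldt_nonneg n
        gcongr
    _ = _ := by rw [← Real.rpow_add hx]; simp

/-- The archimedean comparison term `log (z + 1) / 2 + 2`. -/
noncomputable def archimedeanTerm (z : ℂ) : ℂ := 1 / 2 * Complex.log (z + 1) + 2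

theorem shiftedLogDeriv_eq (z : ℂ) :
    shiftedLogDeriv z = deriv riemannZeta₁ z / riemannZeta₁ z + archimedeanTerm z := rfl

theorem differentiableAt_archimedeanTerm {z : ℂ} (hz : 0 < z.re) :
    DifferentiableAt ℂ archimedeanTerm z := by
  have h1 : z + 1 ∈ Complex.slitPlane := Or.inl (by simp; linarith)
  have h2 : DifferentiableAt ℂ (fun z : ℂ => Complex.log (z + 1)) z :=
    (by fun_prop : DifferentiableAt ℂ (fun z : ℂ => z + 1) z).clog h1
  unfold archimedeanTerm
  fun_prop

theorem abs_archimedeanTerm_im_le {z : ℂ} (hz : 0 ≤ z.re) : |(archimedeanTerm z).im| ≤ 1 := by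
  have h0 : 0 ≤ (z + 1).re := by simp; linarith
  have h1 := Complex.abs_arg_le_pi_div_two_iff.2 h0
  have h2 : (archimedeanTerm z).im = 1 / 2 * (z + 1).arg := by
    have : (archimedeanTerm z) = ((1 / 2 : ℝ) : ℂ) * Complex.log (z + 1) + ((2 : ℝ) : ℂ) := by
      simp [archimedeanTerm]
    rw [this, add_im, im_ofReal_mul, ofReal_im, Complex.log_im, add_zero]
  rw [h2, abs_mul, abs_of_pos (by norm_num : (0 : ℝ) < 1 / 2)]
  have := Real.pi_lt_four
  linarith

theorem norm_archimedeanTerm_le {z : ℂ} (hz : 0 ≤ z.re) : ‖archimedeanTerm z‖ ≤ 4 * (‖z‖ + 1) := by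
  have h1 := norm_log_add_one_le hz
  have h2 : ‖archimedeanTerm z‖ ≤ 1 / 2 * ‖Complex.log (z + 1)‖ + 2 := by
    refine (norm_add_le _ _).trans ?_
    rw [norm_mul]
    norm_num
  linarith [norm_nonneg z]

/-- The remainder of the truncated Dirichlet series of `ζ'/ζ`. -/
noncomputable def truncationRemainder (x : ℝ) (M : ℕ) (z : ℂ) : ℂ :=
  shiftedLogDeriv z - archimedeanTerm z + vonMangoldtSum M z - truncatedPole x z

theorem truncationRemainder_eq {x : ℝ} {M : ℕ} {z : ℂ} (h1 : z ≠ 1) (h0 : riemannZeta z ≠ 0) :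
    truncationRemainder x M z = deriv riemannZeta z / riemannZeta z + vonMangoldtSum M z +
      (x : ℂ) ^ (1 - z) / (z - 1) := by
  rw [truncationRemainder, shiftedLogDeriv_eq, logDeriv_riemannZeta₁_eq h1 h0,
    truncatedPole_of_ne h1, sub_div]
  ring

theorem rpow_mul_norm_truncationRemainder_le_of_two_le {a x : ℝ} {M : ℕ} (hx : 1 < x)
    (hxM : x ≤ M) (ha0 : 0 < a) {z : ℂ} (h2 : 2 ≤ z.re) :
    x ^ (z.re - a) * ‖truncationRemainder x M z‖ ≤ vonMangoldtTwo * x ^ (2 : ℝ) + x := by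
  have hx0 : 0 < x := by linarith
  have hc := vonMangoldtTwo_nonneg
  have hz1 : 1 ≤ ‖z - 1‖ := by
    have := Complex.abs_re_le_norm (z - 1)
    rw [sub_re, one_re] at this
    linarith [le_abs_self (z.re - 1)]
  have hzne : z ≠ 1 := by rintro rfl; norm_num at hz1
  have hM : 0 < M := by
    have : (0 : ℝ) < M := by linarith
    exact_mod_cast this
  have hζ : riemannZeta z ≠ 0 := riemannZeta_ne_zero_of_one_lt_re (by linarith)
  have e1 := norm_logDeriv_zeta_add_vonMangoldtSum_le h2 hM
  have e2 : (M : ℝ) ^ (2 - z.re) ≤ x ^ (2 - z.re) :=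
    Real.rpow_le_rpow_of_nonpos hx0 hxM (by linarith)
  have e3 : ‖(x : ℂ) ^ (1 - z) / (z - 1)‖ ≤ x ^ (1 - z.re) := by
    rw [norm_div, Complex.norm_cpow_eq_rpow_re_of_pos hx0]
    exact div_le_self (by positivity) hz1
  have e4 : ‖truncationRemainder x M z‖ ≤ vonMangoldtTwo * x ^ (2 - z.re) + x ^ (1 - z.re) := by
    rw [truncationRemainder_eq hzne hζ]
    refine (norm_add_le _ _).trans (add_le_add (e1.trans ?_) e3)
    gcongr
  have e5 : x ^ (z.re - a) * (vonMangoldtTwo * x ^ (2 - z.re) + x ^ (1 - z.re)) ≤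
      vonMangoldtTwo * x ^ (2 : ℝ) + x := by
    have e6 : x ^ (z.re - a) * x ^ (2 - z.re) ≤ x ^ (2 : ℝ) := by
      rw [← Real.rpow_add hx0]
      exact Real.rpow_le_rpow_of_exponent_le hx.le (by linarith)
    have e7 : x ^ (z.re - a) * x ^ (1 - z.re) ≤ x := by
      rw [← Real.rpow_add hx0]
      conv_rhs => rw [← Real.rpow_one x]
      exact Real.rpow_le_rpow_of_exponent_le hx.le (by linarith)
    nlinarith [mul_le_mul_of_nonneg_left e6 hc]
  calc _ ≤ x ^ (z.re - a) * (vonMangoldtTwo * x ^ (2 - z.re) + x ^ (1 - z.re)) := by gcongr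
    _ ≤ vonMangoldtTwo * x ^ (2 : ℝ) + x := e5

theorem exists_rpow_mul_norm_truncationRemainder_le (hRH : RiemannHypothesis) {a x : ℝ} {M : ℕ}
    (ha : 1 / 2 < a) (ha1 : a < 1) (hx : 1 < x) (hxM : x ≤ M) :
    ∃ K, 0 ≤ K ∧ ∀ z : ℂ, a ≤ z.re → 3 ≤ ‖z‖ →
      x ^ (z.re - a) * ‖truncationRemainder x M z‖ ≤ K * (‖z‖ + 1) := by
  obtain ⟨K₁, hK₁, hg⟩ := exists_norm_shiftedLogDeriv_le hRH ha
  set Λ₀ := ∑ n ∈ Finset.range M, ArithmeticFunction.vonMangoldt n * (n : ℝ) ^ (-a) with hL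
  have hL0 : 0 ≤ Λ₀ := Finset.sum_nonneg fun n _ =>
    mul_nonneg ArithmeticFunction.vonMangoldt_nonneg (by positivity)
  have hx0 : 0 < x := by linarith
  have hc := vonMangoldtTwo_nonneg
  refine ⟨x ^ (2 : ℝ) * (K₁ + 4 + Λ₀ + 1 + x) + (vonMangoldtTwo * x ^ (2 : ℝ) + x), by positivity,
    fun z hz hz3 => ?_⟩
  have hz1 : 1 ≤ ‖z - 1‖ := by
    have := norm_sub_le (z - 1) (-1)
    simp only [sub_neg_eq_add, sub_add_cancel, norm_neg, norm_one] at this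
    linarith
  have hzn := norm_nonneg z
  rcases le_total z.re 2 with h2 | h2
  · have e1 : x ^ (z.re - a) ≤ x ^ (2 : ℝ) :=
      Real.rpow_le_rpow_of_exponent_le hx.le (by linarith)
    have e2 : ‖vonMangoldtSum M z‖ ≤ Λ₀ := (norm_vonMangoldtSum_le M z).trans
      (Finset.sum_le_sum fun n _ => vonMangoldt_mul_rpow_le (by linarith))
    have e3 : ‖truncatedPole x z‖ ≤ 1 + x := by
      refine (norm_truncatedPole_le hx0 hz1).trans ?_
      have := Real.rpow_le_rpow_of_exponent_le hx.le (by linarith : 1 - z.re ≤ 1)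
      rw [Real.rpow_one] at this
      linarith
    have e4 : ‖truncationRemainder x M z‖ ≤ (K₁ + 4 + Λ₀ + 1 + x) * (‖z‖ + 1) := by
      have h3 := hg z hz
      have h4 := norm_archimedeanTerm_le (by linarith : 0 ≤ z.re)
      have h5 : ‖truncationRemainder x M z‖ ≤ ‖shiftedLogDeriv z‖ + ‖archimedeanTerm z‖ +
          ‖vonMangoldtSum M z‖ + ‖truncatedPole x z‖ := by
        refine (norm_sub_le _ _).trans (add_le_add_left ((norm_add_le _ _).trans
          (add_le_add_left (norm_sub_le _ _) _)) _)
      nlinarith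
    calc _ ≤ x ^ (2 : ℝ) * ((K₁ + 4 + Λ₀ + 1 + x) * (‖z‖ + 1)) := by gcongr
      _ ≤ _ := by
        rw [← mul_assoc]
        refine mul_le_mul_of_nonneg_right (le_add_of_nonneg_right (by positivity)) (by linarith)
  · calc _ ≤ vonMangoldtTwo * x ^ (2 : ℝ) + x :=
        rpow_mul_norm_truncationRemainder_le_of_two_le hx hxM (by linarith) h2
      _ ≤ (vonMangoldtTwo * x ^ (2 : ℝ) + x) * (‖z‖ + 1) :=
        le_mul_of_one_le_right (by positivity) (by linarith)
      _ ≤ _ := mul_le_mul_of_nonneg_right (le_add_of_nonneg_left (by positivity)) (by linarith)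

/-- A function holomorphic in `a ≤ re z` whose real part on the line `re z = a` is
`(1 - ε cos α) Re (ζ'/ζ + …)` up to a bounded error, where `α = (im z - t) log x`. -/
noncomputable def comparisonFunction (ε a t x : ℝ) (M : ℕ) (z : ℂ) : ℂ :=
  shiftedLogDeriv z * (1 - ε / 2 * (x : ℂ) ^ (-(z - a - t * Complex.I))) -
    ε / 2 * ((x : ℂ) ^ (z - a - t * Complex.I) * truncationRemainder x M z -
      (x : ℂ) ^ (-(z - a - t * Complex.I)) * vonMangoldtSum M (2 * a - z) +
      (x : ℂ) ^ (-(z - a - t * Complex.I)) * truncatedPole x (2 * a - z) +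
      (x : ℂ) ^ (-(z - a - t * Complex.I)) * archimedeanTerm z)

section

variable {ε a t x : ℝ} {M : ℕ}

theorem differentiableAt_comparisonFunction (hRH : RiemannHypothesis) (ha : 1 / 2 < a)
    (hx : 0 < x) {z : ℂ} (hz : a ≤ z.re) :
    DifferentiableAt ℂ (comparisonFunction ε a t x M) z := by
  have hx0 : (x : ℂ) ≠ 0 := by exact_mod_cast hx.ne'
  have h1 := differentiableAt_shiftedLogDeriv hRH (by linarith : 1 / 2 < z.re)
  have h2 := differentiableAt_archimedeanTerm (by linarith : 0 < z.re)
  have h3 := differentiable_vonMangoldtSum M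
  have h4 := differentiable_truncatedPole hx
  have h5 : DifferentiableAt ℂ (fun z : ℂ => (x : ℂ) ^ (z - a - t * Complex.I)) z :=
    DifferentiableAt.const_cpow (by fun_prop) (Or.inl hx0)
  have h6 : DifferentiableAt ℂ (fun z : ℂ => (x : ℂ) ^ (-(z - a - t * Complex.I))) z :=
    DifferentiableAt.const_cpow (by fun_prop) (Or.inl hx0)
  have h7 : DifferentiableAt ℂ (truncationRemainder x M) z :=
    ((h1.sub h2).add (h3 z)).sub (h4 z)
  have h8 : DifferentiableAt ℂ (fun z => vonMangoldtSum M (2 * a - z)) z :=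
    (h3 _).comp z (by fun_prop)
  have h9 : DifferentiableAt ℂ (fun z => truncatedPole x (2 * a - z)) z :=
    (h4 _).comp z (by fun_prop)
  unfold comparisonFunction
  exact (h1.mul ((h6.const_mul _).const_sub 1)).sub
    (((((h5.mul h7).sub (h6.mul h8)).add (h6.mul h9)).add (h6.mul h2)).const_mul _)

theorem norm_cpow_sub (hx : 0 < x) (z : ℂ) :
    ‖(x : ℂ) ^ (z - a - t * Complex.I)‖ = x ^ (z.re - a) := by
  rw [Complex.norm_cpow_eq_rpow_re_of_pos hx]; simp

theorem norm_cpow_neg_sub (hx : 0 < x) (z : ℂ) :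
    ‖(x : ℂ) ^ (-(z - a - t * Complex.I))‖ = x ^ (-(z.re - a)) := by
  rw [Complex.norm_cpow_eq_rpow_re_of_pos hx]; simp

theorem norm_reflected_terms_le (hx : 1 < x) (hM : ∀ n < M, (n : ℝ) ≤ x) (ha0 : 0 < a) (ha1 : a < 1)
    {z : ℂ} (hz : a ≤ z.re) (hz3 : 3 ≤ ‖z‖) :
    x ^ (-(z.re - a)) * ‖vonMangoldtSum M (2 * a - z)‖ +
      x ^ (-(z.re - a)) * ‖truncatedPole x (2 * a - z)‖ ≤
    (∑ n ∈ Finset.range M, ArithmeticFunction.vonMangoldt n * (n : ℝ) ^ (-a)) + (1 + x) := by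
  have hx0 : 0 < x := by linarith
  refine add_le_add (rpow_mul_norm_vonMangoldtSum_le hx0 hM (by linarith) (by simp; linarith)) ?_
  have h1 : 1 ≤ ‖2 * (a : ℂ) - z - 1‖ := by
    have h := norm_sub_le (2 * (a : ℂ) - z - 1) (2 * a - 1)
    have e : 2 * (a : ℂ) - z - 1 - (2 * a - 1) = -z := by ring
    have e2 : ‖2 * (a : ℂ) - 1‖ ≤ 1 := by
      have : (2 * (a : ℂ) - 1) = ((2 * a - 1 : ℝ) : ℂ) := by push_cast; ring
      rw [this, Complex.norm_real, Real.norm_eq_abs, abs_le]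
      constructor <;> linarith
    rw [e, norm_neg] at h
    linarith
  have h2 := norm_truncatedPole_le hx0 h1
  have h3 : (1 : ℝ) - (2 * (a : ℂ) - z).re = 1 - 2 * a + z.re := by simp; ring
  rw [h3] at h2
  have h4 : x ^ (-(z.re - a)) ≤ 1 := Real.rpow_le_one_of_one_le_of_nonpos hx.le (by linarith)
  have h5 : x ^ (-(z.re - a)) * x ^ (1 - 2 * a + z.re) ≤ x := by
    rw [← Real.rpow_add hx0]
    conv_rhs => rw [← Real.rpow_one x]
    exact Real.rpow_le_rpow_of_exponent_le hx.le (by linarith)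
  nlinarith [mul_le_mul_of_nonneg_left h2 (by positivity : 0 ≤ x ^ (-(z.re - a)))]

theorem norm_comparisonFunction_sub_le (hx : 1 < x) (hM : ∀ n < M, (n : ℝ) ≤ x) (ha0 : 0 < a)
    (ha1 : a < 1) (hε : |ε| ≤ 1) {z : ℂ} (hz : a ≤ z.re) (hz3 : 3 ≤ ‖z‖) :
    ‖comparisonFunction ε a t x M z - shiftedLogDeriv z‖ ≤
      x ^ (-(z.re - a)) * (‖shiftedLogDeriv z‖ + ‖archimedeanTerm z‖) +
        x ^ (z.re - a) * ‖truncationRemainder x M z‖ +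
        ((∑ n ∈ Finset.range M, ArithmeticFunction.vonMangoldt n * (n : ℝ) ^ (-a)) + (1 + x)) := by
  have hx0 : 0 < x := by linarith
  have h1 := norm_reflected_terms_le hx hM ha0 ha1 hz hz3
  have e : comparisonFunction ε a t x M z - shiftedLogDeriv z =
    -(ε / 2 * (shiftedLogDeriv z * (x : ℂ) ^ (-(z - a - t * Complex.I)) +
      ((x : ℂ) ^ (z - a - t * Complex.I) * truncationRemainder x M z -
      (x : ℂ) ^ (-(z - a - t * Complex.I)) * vonMangoldtSum M (2 * a - z) +
      (x : ℂ) ^ (-(z - a - t * Complex.I)) * truncatedPole x (2 * a - z) +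
      (x : ℂ) ^ (-(z - a - t * Complex.I)) * archimedeanTerm z))) := by
    rw [comparisonFunction]; ring
  have hε2 : ‖(ε : ℂ) / 2‖ ≤ 1 := by
    rw [norm_div, Complex.norm_real, Real.norm_eq_abs]; norm_num; linarith
  rw [e, norm_neg, norm_mul]
  refine (mul_le_of_le_one_left (norm_nonneg _) hε2).trans ?_
  refine (norm_add_le _ _).trans ?_
  refine (add_le_add_right ((norm_add_le _ _).trans (add_le_add_left
    ((norm_add_le _ _).trans (add_le_add_left (norm_sub_le _ _) _)) _)) _).trans ?_
  simp only [norm_mul, norm_cpow_sub hx0, norm_cpow_neg_sub hx0]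
  nlinarith

theorem exists_norm_comparisonFunction_le (hRH : RiemannHypothesis) (hx : 1 < x)
    (hM : ∀ n < M, (n : ℝ) ≤ x) (hxM : x ≤ M) (ha : 1 / 2 < a) (ha1 : a < 1) (hε : |ε| ≤ 1) :
    ∃ K, 0 ≤ K ∧ ∀ z : ℂ, a ≤ z.re → 3 ≤ ‖z‖ →
      ‖comparisonFunction ε a t x M z‖ ≤ K * (‖z‖ + 1) := by
  obtain ⟨K₁, hK₁, hg⟩ := exists_norm_shiftedLogDeriv_le hRH ha
  obtain ⟨K₂, hK₂, hU⟩ := exists_rpow_mul_norm_truncationRemainder_le hRH ha ha1 hx hxM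
  set Λ₀ := ∑ n ∈ Finset.range M, ArithmeticFunction.vonMangoldt n * (n : ℝ) ^ (-a) with hL
  have hL0 : 0 ≤ Λ₀ := Finset.sum_nonneg fun n _ =>
    mul_nonneg ArithmeticFunction.vonMangoldt_nonneg (by positivity)
  refine ⟨2 * K₁ + 4 + K₂ + (Λ₀ + (1 + x)), by positivity, fun z hz hz3 => ?_⟩
  have h1 := norm_comparisonFunction_sub_le (t := t) hx hM (by linarith) ha1 hε hz hz3
  have h2 := norm_add_le (comparisonFunction ε a t x M z - shiftedLogDeriv z) (shiftedLogDeriv z)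
  rw [sub_add_cancel] at h2
  have h3 := hg z hz
  have h4 := norm_archimedeanTerm_le (by linarith : 0 ≤ z.re)
  have h5 := hU z hz hz3
  have h6 : x ^ (-(z.re - a)) ≤ 1 := Real.rpow_le_one_of_one_le_of_nonpos hx.le (by linarith)
  have h7 := mul_le_of_le_one_left
    (by positivity : 0 ≤ ‖shiftedLogDeriv z‖ + ‖archimedeanTerm z‖) h6
  rw [← hL] at h1
  nlinarith [norm_nonneg z, mul_nonneg (by positivity : 0 ≤ Λ₀ + (1 + x)) (norm_nonneg z)]

theorem exists_neg_le_comparisonFunction_re (hRH : RiemannHypothesis) (hx : 1 < x)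
    (hM : ∀ n < M, (n : ℝ) ≤ x) (hxM : x ≤ M) (ha : 1 / 2 < a) (ha1 : a < 1) (hε : |ε| ≤ 1) :
    ∃ K', ∀ᶠ σ : ℝ in Filter.atTop, -K' ≤ (comparisonFunction ε a t x M σ).re := by
  obtain ⟨K₁, hK₁, hg⟩ := exists_norm_shiftedLogDeriv_le hRH ha
  have hx0 : 0 < x := by linarith
  have hlx := Real.log_pos hx
  set Λ₀ := ∑ n ∈ Finset.range M, ArithmeticFunction.vonMangoldt n * (n : ℝ) ^ (-a) with hL
  obtain ⟨K₂, hK₂, hU⟩ : ∃ K, 0 ≤ K ∧ ∀ σ : ℝ, 3 ≤ σ →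
      x ^ (σ - a) * ‖truncationRemainder x M σ‖ ≤ K := by
    have hM0 : 0 < M := by
      have : (0 : ℝ) < M := by linarith
      exact_mod_cast this
    have hc := vonMangoldtTwo_nonneg
    refine ⟨vonMangoldtTwo * x ^ (2 : ℝ) + x, by positivity, fun σ hσ => ?_⟩
    have h := rpow_mul_norm_truncationRemainder_le_of_two_le (a := a) (z := (σ : ℂ)) hx hxM
      (by linarith) (by rw [ofReal_re]; linarith)
    rwa [ofReal_re] at h
  refine ⟨(K₁ + 4) * (2 + 1 / Real.log x) + K₂ + (Λ₀ + (1 + x)), ?_⟩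
  filter_upwards [Filter.eventually_ge_atTop 3] with σ hσ
  have hnorm : ‖(σ : ℂ)‖ = σ := by rw [Complex.norm_real, Real.norm_of_nonneg (by linarith)]
  have h1 := norm_comparisonFunction_sub_le (t := t) hx hM (by linarith) ha1 hε
    (z := σ) (by simp; linarith) (by rw [hnorm]; exact hσ)
  have h2 := shiftedLogDeriv_re_nonneg hRH (z := σ) (by simp; linarith)
  have h3 := hg σ (by simp; linarith)
  have h4 := norm_archimedeanTerm_le (z := σ) (by simp; linarith)
  have h5 := hU σ hσ
  have h6 := neg_le_of_abs_le ((Complex.abs_re_le_norm _).trans h1)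
  rw [sub_re] at h6
  rw [hnorm] at h3 h4
  have h7 : x ^ (-(σ - a)) * (σ + 1) ≤ 2 + 1 / Real.log x := by
    have e1 : x ^ (σ - a) ≥ 1 + (σ - a) * Real.log x := by
      rw [Real.rpow_def_of_pos hx0]
      linarith [Real.add_one_le_exp (Real.log x * (σ - a))]
    rw [Real.rpow_neg hx0.le, inv_mul_le_iff₀ (by positivity)]
    have e2 : (1 + (σ - a) * Real.log x) * (2 + 1 / Real.log x) =
        2 + 1 / Real.log x + 2 * (σ - a) * Real.log x + (σ - a) := by field_simp; ring
    have e3 : (0 : ℝ) < 1 / Real.log x := by positivity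
    have e4 : 0 ≤ (σ - a) * Real.log x := mul_nonneg (by linarith) hlx.le
    nlinarith [mul_le_mul_of_nonneg_right e1 (by positivity : 0 ≤ 2 + 1 / Real.log x)]
  have h8 : x ^ (-(σ - a)) * (‖shiftedLogDeriv σ‖ + ‖archimedeanTerm σ‖) ≤
      (K₁ + 4) * (2 + 1 / Real.log x) := by
    calc _ ≤ x ^ (-(σ - a)) * ((K₁ + 4) * (σ + 1)) := by gcongr; linarith
      _ = (K₁ + 4) * (x ^ (-(σ - a)) * (σ + 1)) := by ring
      _ ≤ _ := by gcongr
  simp only [ofReal_re] at h6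
  linarith

theorem neg_one_le_comparisonFunction_re_of_re_eq (hRH : RiemannHypothesis) (hx : 0 < x)
    (ha : 1 / 2 < a) (ha1 : a < 1) (hε : |ε| ≤ 1) {z : ℂ} (hz : z.re = a) :
    -1 ≤ (comparisonFunction ε a t x M z).re := by
  have hz1 : z ≠ 1 := by rintro rfl; simp at hz; linarith
  have e1 : 2 * (a : ℂ) - z = starRingEnd ℂ z := by
    apply Complex.ext <;> simp [hz]; ring
  have harg : (x : ℂ).arg ≠ π := by
    rw [Complex.arg_ofReal_of_nonneg hx.le]; exact Real.pi_pos.ne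
  set P : ℂ := (x : ℂ) ^ (z - a - t * Complex.I) with hP
  have e2 : (x : ℂ) ^ (-(z - a - t * Complex.I)) = starRingEnd ℂ P := by
    have h := Complex.cpow_conj (x : ℂ) (z - a - t * Complex.I) harg
    rw [Complex.conj_ofReal] at h
    rw [hP, ← h]
    congr 1
    apply Complex.ext <;> simp [hz]
    ring
  have hPn : ‖P‖ = 1 := by rw [hP, norm_cpow_sub hx, hz]; simp
  rw [comparisonFunction, e1, e2, ← hP, vonMangoldtSum_conj, truncatedPole_conj hx hz1,
    truncationRemainder]
  have hg := shiftedLogDeriv_re_nonneg hRH (by rw [hz]; exact ha : 1 / 2 < z.re)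
  have hB := abs_archimedeanTerm_im_le (by rw [hz]; linarith : 0 ≤ z.re)
  generalize shiftedLogDeriv z = g at *
  generalize archimedeanTerm z = B at *
  generalize vonMangoldtSum M z = D
  generalize truncatedPole x z = k
  have hre : |P.re| ≤ 1 := hPn ▸ Complex.abs_re_le_norm P
  have him : |P.im| ≤ 1 := hPn ▸ Complex.abs_im_le_norm P
  have key : (g * (1 - ε / 2 * starRingEnd ℂ P) - ε / 2 * (P * (g - B + D - k) -
      starRingEnd ℂ P * starRingEnd ℂ D + starRingEnd ℂ P * starRingEnd ℂ k +
      starRingEnd ℂ P * B)).re = g.re * (1 - ε * P.re) - ε * (P.im * B.im) := by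
    have e3 : (ε : ℂ) / 2 = ((ε / 2 : ℝ) : ℂ) := by push_cast; ring
    rw [e3]
    simp
    ring
  rw [key]
  have h1 : |ε * P.re| ≤ 1 := by rw [abs_mul]; exact mul_le_one₀ hε (abs_nonneg _) hre
  have h2 : |ε * (P.im * B.im)| ≤ 1 := by
    rw [abs_mul, abs_mul]
    exact mul_le_one₀ hε (by positivity) (mul_le_one₀ him (abs_nonneg _) hB)
  have := le_of_abs_le h2
  have := mul_nonneg hg (by linarith [le_of_abs_le h1] : 0 ≤ 1 - ε * P.re)
  linarith

theorem neg_one_le_comparisonFunction_re (hRH : RiemannHypothesis) (hx : 1 < x)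
    (hM : ∀ n < M, (n : ℝ) ≤ x) (hxM : x ≤ M) (ha : 1 / 2 < a) (ha1 : a < 1) (hε : |ε| ≤ 1)
    {z : ℂ} (hz : a ≤ z.re) : -1 ≤ (comparisonFunction ε a t x M z).re := by
  obtain ⟨K, hK, h1⟩ := exists_norm_comparisonFunction_le (t := t) hRH hx hM hxM ha ha1 hε
  obtain ⟨K', h2⟩ := exists_neg_le_comparisonFunction_re (t := t) hRH hx hM hxM ha ha1 hε
  exact neg_one_le_re_of_phragmenLindelof (by linarith) ha1 hK
    (fun z hz => differentiableAt_comparisonFunction hRH ha (by linarith) hz) h1 h2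
    (fun z hz => neg_one_le_comparisonFunction_re_of_re_eq hRH (by linarith) ha ha1 hε hz) hz

end

theorem comparison_inequality_of_half_lt (hRH : RiemannHypothesis) {ε a s t x : ℝ} {M : ℕ}
    (hx : 1 < x) (hM : ∀ n < M, (n : ℝ) ≤ x) (hxM : x ≤ M) (ha : 1 / 2 < a) (ha1 : a < 1)
    (hε : |ε| ≤ 1) (hs : 0 ≤ s) (ht : 1 ≤ t) :
    0 ≤ (shiftedLogDeriv ((a + s : ℝ) + t * Complex.I)).re *
        (2 * x ^ (-s) - ε * (x ^ (-s)) ^ 2 - ε) +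
      ε * (archimedeanTerm ((a + s : ℝ) + t * Complex.I)).re * (1 - (x ^ (-s)) ^ 2) +
      (2 * (∑ n ∈ Finset.range M, ArithmeticFunction.vonMangoldt n * (n : ℝ) ^ (-(1 / 2 : ℝ))) +
        2 * x ^ (1 / 2 : ℝ) + 4) := by
  have hx0 : 0 < x := by linarith
  set w : ℂ := (a + s : ℝ) + t * Complex.I with hw
  have hwre : w.re = a + s := by simp [hw]
  have h1 := neg_one_le_comparisonFunction_re (t := t) hRH hx hM hxM ha ha1 hε (z := w)
    (by rw [hwre]; linarith)
  have ew : w - a - t * Complex.I = ((s : ℝ) : ℂ) := by rw [hw]; push_cast; ring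
  have ep : (x : ℂ) ^ (w - a - t * Complex.I) = ((x ^ s : ℝ) : ℂ) := by
    rw [ew, Complex.ofReal_cpow hx0.le]
  have em : (x : ℂ) ^ (-(w - a - t * Complex.I)) = ((x ^ (-s) : ℝ) : ℂ) := by
    rw [ew, ← Complex.ofReal_neg, Complex.ofReal_cpow hx0.le]
  rw [comparisonFunction, ep, em, truncationRemainder] at h1
  set Λ₀ := ∑ n ∈ Finset.range M, ArithmeticFunction.vonMangoldt n * (n : ℝ) ^ (-(1 / 2 : ℝ))
  have hq0 : 0 < x ^ (-s) := by positivity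
  have hq1 : x ^ (-s) ≤ 1 := Real.rpow_le_one_of_one_le_of_nonpos hx.le (by linarith)
  have hqs : (x ^ (-s)) ^ 2 = x ^ (-(2 * s)) := by
    rw [← Real.rpow_natCast, ← Real.rpow_mul hx0.le]; congr 1; push_cast; ring
  have hpq : x ^ (-s) * x ^ s = 1 := by rw [← Real.rpow_add hx0]; simp
  have hD : |(vonMangoldtSum M w).re| ≤ Λ₀ := by
    have h := rpow_mul_norm_vonMangoldtSum_le (M := M) (z := w) (b := 1 / 2) (c := 0) hx0 hM le_rfl
      (by rw [hwre]; linarith)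
    rw [neg_zero, Real.rpow_zero, one_mul] at h
    exact (Complex.abs_re_le_norm _).trans h
  have hD' : |(x ^ (-s)) ^ 2 * (vonMangoldtSum M (2 * a - w)).re| ≤ Λ₀ := by
    have h := rpow_mul_norm_vonMangoldtSum_le (M := M) (z := 2 * a - w) (b := 1 / 2) (c := 2 * s)
      hx0 hM (by linarith) (by simp [hwre]; linarith)
    rw [hqs, abs_mul, abs_of_pos (by positivity : 0 < x ^ (-(2 * s)))]
    exact (mul_le_mul_of_nonneg_left (Complex.abs_re_le_norm _) (by positivity)).trans h
  have hκ : |(truncatedPole x w).re| ≤ 1 + x ^ (1 / 2 : ℝ) := by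
    have h0 : 1 ≤ ‖w - 1‖ := by
      have := Complex.abs_im_le_norm (w - 1)
      have e : (w - 1).im = t := by simp [hw]
      rw [e] at this
      linarith [le_abs_self t]
    refine ((Complex.abs_re_le_norm _).trans (norm_truncatedPole_le hx0 h0)).trans ?_
    have := Real.rpow_le_rpow_of_exponent_le hx.le (by rw [hwre]; linarith : 1 - w.re ≤ 1 / 2)
    linarith
  have hκ' : |(x ^ (-s)) ^ 2 * (truncatedPole x (2 * a - w)).re| ≤ 1 + x ^ (1 / 2 : ℝ) := by
    have h0 : 1 ≤ ‖2 * (a : ℂ) - w - 1‖ := by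
      have := Complex.abs_im_le_norm (2 * (a : ℂ) - w - 1)
      have e : (2 * (a : ℂ) - w - 1).im = -t := by simp [hw]
      rw [e, abs_neg] at this
      linarith [le_abs_self t]
    have h2 := norm_truncatedPole_le hx0 h0
    have h3 : (1 : ℝ) - (2 * (a : ℂ) - w).re = 1 - a + s := by simp [hwre]; ring
    rw [h3] at h2
    have h4 : (x ^ (-s)) ^ 2 * x ^ (1 - a + s) ≤ x ^ (1 / 2 : ℝ) := by
      rw [hqs, ← Real.rpow_add hx0]
      exact Real.rpow_le_rpow_of_exponent_le hx.le (by linarith)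
    have h5 : (x ^ (-s)) ^ 2 ≤ 1 := pow_le_one₀ hq0.le hq1
    rw [abs_mul, abs_of_nonneg (by positivity : 0 ≤ (x ^ (-s)) ^ 2)]
    have h6 := (Complex.abs_re_le_norm _).trans h2
    nlinarith [mul_le_mul_of_nonneg_left h6 (by positivity : 0 ≤ (x ^ (-s)) ^ 2)]
  generalize vonMangoldtSum M (2 * a - w) = D' at *
  generalize truncatedPole x (2 * a - w) = k' at *
  generalize vonMangoldtSum M w = D at *
  generalize truncatedPole x w = k at *
  generalize shiftedLogDeriv w = g at *
  generalize archimedeanTerm w = B at *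
  set q := x ^ (-s)
  set p := x ^ s
  have key : (g * (1 - ε / 2 * (q : ℂ)) - ε / 2 * ((p : ℂ) * (g - B + D - k) - (q : ℂ) * D' +
      (q : ℂ) * k' + (q : ℂ) * B)).re = g.re * (1 - ε / 2 * q) -
      ε / 2 * (p * (g.re - B.re + D.re - k.re) - q * D'.re + q * k'.re + q * B.re) := by
    have e3 : (ε : ℂ) / 2 = ((ε / 2 : ℝ) : ℂ) := by push_cast; ring
    rw [e3]
    simp
  rw [key] at h1
  have h2 := mul_le_mul_of_nonneg_left h1 (by positivity : 0 ≤ 2 * q)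
  have e : 2 * q * (g.re * (1 - ε / 2 * q) -
      ε / 2 * (p * (g.re - B.re + D.re - k.re) - q * D'.re + q * k'.re + q * B.re)) =
      g.re * (2 * q - ε * q ^ 2) - ε * ((q * p) * (g.re - B.re + D.re - k.re) - q ^ 2 * D'.re +
        q ^ 2 * k'.re + q ^ 2 * B.re) := by ring
  rw [e, hpq] at h2
  have h3 : |ε * (D.re - k.re - q ^ 2 * D'.re + q ^ 2 * k'.re)| ≤
      2 * Λ₀ + 2 * (1 + x ^ (1 / 2 : ℝ)) := by
    rw [abs_mul]
    refine (mul_le_of_le_one_left (abs_nonneg _) hε).trans (abs_le.2 ?_)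
    have := abs_le.1 hD
    have := abs_le.1 hD'
    have := abs_le.1 hκ
    have := abs_le.1 hκ'
    constructor <;> linarith
  have := le_of_abs_le h3
  have := neg_le_of_abs_le h3
  nlinarith

theorem continuousAt_const_rpow_neg {x s : ℝ} (hx : 0 < x) :
    ContinuousAt (fun r : ℝ => x ^ (-r)) s :=
  (Real.continuousAt_const_rpow hx.ne').comp (by fun_prop)

theorem sum_range_succ_rpow_neg_half_le (m : ℕ) :
    ∑ n ∈ Finset.range (m + 1), (n : ℝ) ^ (-(1 / 2 : ℝ)) ≤ 2 * √m := by
  induction m with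
  | zero => simp [Real.zero_rpow]
  | succ k ih =>
    rw [Finset.sum_range_succ]
    have h0 : (0 : ℝ) < ((k + 1 : ℕ) : ℝ) := by positivity
    have e : (((k + 1 : ℕ) : ℝ)) ^ (-(1 / 2 : ℝ)) = 1 / √((k + 1 : ℕ) : ℝ) := by
      rw [Real.rpow_neg h0.le, ← Real.sqrt_eq_rpow, one_div]
    have hb : 0 < √((k + 1 : ℕ) : ℝ) := Real.sqrt_pos.2 h0
    have ha := Real.sqrt_nonneg (k : ℝ)
    have h1 := Real.sq_sqrt h0.le
    have h2 := Real.sq_sqrt (Nat.cast_nonneg k : (0 : ℝ) ≤ k)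
    have h3 : 1 / √((k + 1 : ℕ) : ℝ) ≤ 2 * √((k + 1 : ℕ) : ℝ) - 2 * √(k : ℝ) := by
      rw [div_le_iff₀ hb]
      push_cast at h1 ⊢
      nlinarith [sq_nonneg (√((k : ℝ) + 1) - √(k : ℝ))]
    rw [e]
    linarith

theorem sum_vonMangoldt_mul_rpow_neg_half_le {x : ℝ} (hx : 1 < x) :
    ∑ n ∈ Finset.range ⌈x⌉₊, ArithmeticFunction.vonMangoldt n * (n : ℝ) ^ (-(1 / 2 : ℝ)) ≤
      2 * (√x * Real.log x) := by
  have hx0 : 0 < x := by linarith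
  obtain ⟨m, hm⟩ : ∃ m, ⌈x⌉₊ = m + 1 :=
    Nat.exists_eq_succ_of_ne_zero (Nat.ceil_pos.2 hx0).ne'
  have hmx : (m : ℝ) ≤ x := (Nat.lt_ceil.1 (by omega)).le
  have h1 : ∀ n ∈ Finset.range ⌈x⌉₊,
      ArithmeticFunction.vonMangoldt n * (n : ℝ) ^ (-(1 / 2 : ℝ)) ≤
        Real.log x * (n : ℝ) ^ (-(1 / 2 : ℝ)) := by
    intro n hn
    rcases eq_or_ne n 0 with rfl | h0
    · simp [Real.zero_rpow]
    have hnx : (n : ℝ) ≤ x := (Nat.lt_ceil.1 (Finset.mem_range.1 hn)).le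
    have hn0 : (0 : ℝ) < n := by exact_mod_cast Nat.pos_of_ne_zero h0
    have := ArithmeticFunction.vonMangoldt_le_log (n := n)
    have := Real.log_le_log hn0 hnx
    gcongr
    linarith
  refine (Finset.sum_le_sum h1).trans ?_
  rw [← Finset.mul_sum, hm]
  have h2 := sum_range_succ_rpow_neg_half_le m
  have h3 := Real.sqrt_le_sqrt hmx
  have h4 := Real.log_pos hx
  nlinarith

/-- The size of the error terms coming from a Dirichlet polynomial of length `x`. -/
noncomputable def truncationError (x : ℝ) : ℝ := 4 * (√x * Real.log x) + 2 * √x + 4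

theorem truncationError_pos {x : ℝ} (hx : 1 < x) : 0 < truncationError x := by
  have := Real.log_pos hx
  unfold truncationError
  positivity

theorem comparison_inequality (hRH : RiemannHypothesis) {ε s t x : ℝ} (hx : 1 < x)
    (hε : |ε| ≤ 1) (hs : 0 < s) (ht : 1 ≤ t) :
    0 ≤ (shiftedLogDeriv ((1 / 2 + s : ℝ) + t * Complex.I)).re *
        (2 * x ^ (-s) - ε * (x ^ (-s)) ^ 2 - ε) +
      ε * (archimedeanTerm ((1 / 2 + s : ℝ) + t * Complex.I)).re * (1 - (x ^ (-s)) ^ 2) +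
      truncationError x := by
  set F := (shiftedLogDeriv ((1 / 2 + s : ℝ) + t * Complex.I)).re
  set b := (archimedeanTerm ((1 / 2 + s : ℝ) + t * Complex.I)).re
  have hx0 : 0 < x := by linarith
  have h1 : ∀ᶠ r : ℝ in nhdsWithin s (Set.Iio s), 0 ≤ F * (2 * x ^ (-r) - ε * (x ^ (-r)) ^ 2 - ε) +
      ε * b * (1 - (x ^ (-r)) ^ 2) + truncationError x := by
    have hlt : max (s - 1 / 2) 0 < s := max_lt (by linarith) hs
    filter_upwards [Ioo_mem_nhdsLT hlt] with r hr
    obtain ⟨hr1, hr2⟩ := hr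
    have hr3 := (le_max_left _ _).trans_lt hr1
    have hr4 := (le_max_right _ _).trans_lt hr1
    have h := comparison_inequality_of_half_lt (a := 1 / 2 + s - r) (s := r) hRH hx
      (M := ⌈x⌉₊) (fun n hn => (Nat.lt_ceil.1 hn).le) (Nat.le_ceil x) (by linarith) (by linarith)
      hε hr4.le ht
    rw [show 1 / 2 + s - r + r = 1 / 2 + s by ring] at h
    have h2 := sum_vonMangoldt_mul_rpow_neg_half_le hx
    rw [← Real.sqrt_eq_rpow] at h
    unfold truncationError
    linarith
  refine ge_of_tendsto (Filter.Tendsto.mono_left ?_ nhdsWithin_le_nhds) h1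
  have hc := continuousAt_const_rpow_neg (s := s) hx0
  have : ContinuousAt (fun r : ℝ => F * (2 * x ^ (-r) - ε * (x ^ (-r)) ^ 2 - ε) +
      ε * b * (1 - (x ^ (-r)) ^ 2) + truncationError x) s := by fun_prop
  exact this

theorem riemannZeta_ne_zero_of_half_lt (hRH : RiemannHypothesis) {z : ℂ} (hz : 1 / 2 < z.re)
    (h1 : z ≠ 1) : riemannZeta z ≠ 0 := fun h =>
  riemannZeta₁_ne_zero hRH hz (by rw [riemannZeta₁_eq_mul h1, h, mul_zero])

/-- `log |ζ(1/2 + s + i t)|`. -/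
noncomputable def logNormZeta (t s : ℝ) : ℝ :=
  Real.log ‖riemannZeta ((1 / 2 + s : ℝ) + t * Complex.I)‖

/-- `Re (ζ'/ζ)(1/2 + s + i t)`. -/
noncomputable def reLogDerivZeta (t s : ℝ) : ℝ :=
  (deriv riemannZeta ((1 / 2 + s : ℝ) + t * Complex.I) /
    riemannZeta ((1 / 2 + s : ℝ) + t * Complex.I)).re

theorem ne_one_of_im_ne_zero {a t : ℝ} (ht : t ≠ 0) : (a : ℂ) + t * Complex.I ≠ 1 := fun h =>
  ht (by simpa using congrArg Complex.im h)

theorem hasDerivAt_logNormZeta (hRH : RiemannHypothesis) {s t : ℝ} (hs : 0 < s) (ht : t ≠ 0) :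
    HasDerivAt (logNormZeta t) (reLogDerivZeta t s) s := by
  have h1 : ((1 / 2 + s : ℝ) : ℂ) + t * Complex.I ≠ 1 := ne_one_of_im_ne_zero ht
  have h0 := riemannZeta_ne_zero_of_half_lt hRH (z := (1 / 2 + s : ℝ) + t * Complex.I)
    (by simp; linarith) h1
  have hline : HasDerivAt (fun r : ℝ => ((1 / 2 + r : ℝ) : ℂ) + t * Complex.I) 1 s :=
    (((hasDerivAt_id s).const_add (1 / 2)).ofReal_comp).add_const _
  have h2 : HasDerivAt (fun r : ℝ => riemannZeta (((1 / 2 + r : ℝ) : ℂ) + t * Complex.I))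
      (deriv riemannZeta (((1 / 2 + s : ℝ) : ℂ) + t * Complex.I) * 1) s :=
    HasDerivAt.comp (h := fun r : ℝ => ((1 / 2 + r : ℝ) : ℂ) + t * Complex.I) (h₂ := riemannZeta)
      s (differentiableAt_riemannZeta h1).hasDerivAt hline
  rw [mul_one] at h2
  exact hasDerivAt_log_norm h2 h0

theorem archimedeanTerm_re_mem_Icc {s t : ℝ} (hs : 0 < s) (hs2 : s ≤ 2) (ht : 1 ≤ t) :
    (archimedeanTerm ((1 / 2 + s : ℝ) + t * Complex.I)).re ∈
      Set.Icc 0 (1 / 2 * Real.log t + 3) := by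
  set w : ℂ := (1 / 2 + s : ℝ) + t * Complex.I with hw
  have e : (archimedeanTerm w).re = 1 / 2 * Real.log ‖w + 1‖ + 2 := by
    have : archimedeanTerm w = ((1 / 2 : ℝ) : ℂ) * Complex.log (w + 1) + ((2 : ℝ) : ℂ) := by
      simp [archimedeanTerm]
    rw [this, add_re, re_ofReal_mul, ofReal_re, Complex.log_re]
  have h1 : 1 ≤ ‖w + 1‖ := by
    have := Complex.abs_re_le_norm (w + 1)
    have e2 : (w + 1).re = 1 / 2 + s + 1 := by simp [hw]
    rw [e2] at this
    linarith [le_abs_self (1 / 2 + s + 1)]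
  have h2 : ‖w + 1‖ ≤ 9 / 2 * t := by
    have e3 : w + 1 = ((1 / 2 + s + 1 : ℝ) : ℂ) + t * Complex.I := by rw [hw]; push_cast; ring
    rw [e3]
    refine (norm_add_le _ _).trans ?_
    rw [norm_mul, Complex.norm_I, Complex.norm_real, Complex.norm_real,
      Real.norm_of_nonneg (by linarith), Real.norm_of_nonneg (by linarith)]
    linarith
  have h3 := Real.log_nonneg h1
  have h4 := Real.log_le_log (by linarith) h2
  rw [Real.log_mul (by norm_num) (by linarith)] at h4
  have h5 : Real.log (9 / 2) ≤ 2 := by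
    rw [Real.log_le_iff_le_exp (by norm_num), show (2 : ℝ) = 1 + 1 by norm_num, Real.exp_add]
    have := Real.exp_one_gt_d9
    nlinarith
  rw [e]
  constructor <;> linarith

theorem reLogDerivZeta_eq (hRH : RiemannHypothesis) {s t : ℝ} (hs : 0 < s) (ht : 1 ≤ t) :
    |reLogDerivZeta t s - ((shiftedLogDeriv ((1 / 2 + s : ℝ) + t * Complex.I)).re -
      (archimedeanTerm ((1 / 2 + s : ℝ) + t * Complex.I)).re)| ≤ 1 := by
  have h1 : ((1 / 2 + s : ℝ) : ℂ) + t * Complex.I ≠ 1 := ne_one_of_im_ne_zero (by linarith)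
  have h0 := riemannZeta_ne_zero_of_half_lt hRH (z := (1 / 2 + s : ℝ) + t * Complex.I)
    (by simp; linarith) h1
  unfold reLogDerivZeta
  rw [shiftedLogDeriv_eq, logDeriv_riemannZeta₁_eq h1 h0, add_re, add_re, abs_sub_comm]
  set w : ℂ := (1 / 2 + s : ℝ) + t * Complex.I with hw
  rw [show ∀ a b c : ℝ, a + b + c - c - a = b by intros; ring]
  refine (Complex.abs_re_le_norm _).trans ?_
  have h2 : 1 ≤ ‖w - 1‖ := by
    have := Complex.abs_im_le_norm (w - 1)
    have e2 : (w - 1).im = t := by simp [hw]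
    rw [e2] at this
    linarith [le_abs_self t]
  rw [norm_div, norm_one]
  exact div_le_one_of_le₀ h2 (norm_nonneg _)

theorem neg_le_reLogDerivZeta (hRH : RiemannHypothesis) {s t X : ℝ} (hs : 0 < s) (hs2 : s ≤ 2)
    (ht : 1 ≤ t) (hX : 0 < X) :
    -(2 * (1 / 2 * Real.log t + 3) * (1 / (Real.exp (s * X) + 1))) -
      (truncationError (Real.exp X) + 1) ≤ reLogDerivZeta t s := by
  have h1 := comparison_inequality hRH (ε := -1) (x := Real.exp X) (Real.one_lt_exp_iff.2 hX)
    (by simp) hs ht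
  have h2 := neg_le_of_abs_le (reLogDerivZeta_eq hRH hs ht)
  obtain ⟨h3, h4⟩ := archimedeanTerm_re_mem_Icc hs hs2 ht
  have hR := truncationError_pos (Real.one_lt_exp_iff.2 hX)
  rw [← Real.exp_mul, show X * -s = -(s * X) by ring] at h1
  set q := Real.exp (-(s * X)) with hq
  have hq0 : 0 < q := Real.exp_pos _
  have e : 1 / (Real.exp (s * X) + 1) = q / (1 + q) := by
    rw [hq, Real.exp_neg]; field_simp
  rw [e]
  set F := (shiftedLogDeriv ((1 / 2 + s : ℝ) + t * Complex.I)).re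
  set b := (archimedeanTerm ((1 / 2 + s : ℝ) + t * Complex.I)).re
  set R := truncationError (Real.exp X)
  have h5 : b - 2 * b * (q / (1 + q)) - R ≤ F := by
    have e2 : b - 2 * b * (q / (1 + q)) - R = (b * (1 - q) - R * (1 + q)) / (1 + q) := by
      field_simp; ring
    rw [e2, div_le_iff₀ (by positivity)]
    have h6 : (b * (1 - q) - R * (1 + q)) * (1 + q) ≤ F * (1 + q) * (1 + q) := by
      nlinarith [mul_pos hR hq0]
    exact le_of_mul_le_mul_right h6 (by positivity)
  have h7 : 2 * b * (q / (1 + q)) ≤ 2 * (1 / 2 * Real.log t + 3) * (q / (1 + q)) := by gcongr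
  linarith

theorem shiftedLogDeriv_re_le (hRH : RiemannHypothesis) {s t X : ℝ} (hs : 0 < s)
    (ht : 1 ≤ t) (hX : 0 < X) :
    (shiftedLogDeriv ((1 / 2 + s : ℝ) + t * Complex.I)).re ≤
      (archimedeanTerm ((1 / 2 + s : ℝ) + t * Complex.I)).re *
        (1 + 2 * (1 / (Real.exp (s * X) - 1))) +
        truncationError (Real.exp X) * (1 / (1 - Real.exp (-(s * X)))) ^ 2 := by
  have h1 := comparison_inequality hRH (ε := 1) (x := Real.exp X) (Real.one_lt_exp_iff.2 hX)
    (by simp) hs ht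
  rw [← Real.exp_mul, show X * -s = -(s * X) by ring] at h1
  set q := Real.exp (-(s * X)) with hq
  have hq0 : 0 < q := Real.exp_pos _
  have hq1 : 0 < 1 - q := by
    have : q < 1 := Real.exp_lt_one_iff.2 (by nlinarith)
    linarith
  have e : 1 / (Real.exp (s * X) - 1) = q / (1 - q) := by
    have : Real.exp (s * X) = q⁻¹ := by rw [hq, Real.exp_neg, inv_inv]
    rw [this]; field_simp
  rw [e]
  set F := (shiftedLogDeriv ((1 / 2 + s : ℝ) + t * Complex.I)).re
  set b := (archimedeanTerm ((1 / 2 + s : ℝ) + t * Complex.I)).re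
  set R := truncationError (Real.exp X)
  have e2 : b * (1 + 2 * (q / (1 - q))) + R * (1 / (1 - q)) ^ 2 =
      (b * (1 - q ^ 2) + R) / (1 - q) ^ 2 := by
    field_simp; ring
  rw [e2, le_div_iff₀ (by positivity)]
  nlinarith

theorem reLogDerivZeta_le (hRH : RiemannHypothesis) {s t X : ℝ} (hs : 0 < s) (hs2 : s ≤ 2)
    (ht : 1 ≤ t) (hX : 0 < X) :
    reLogDerivZeta t s ≤ 2 * (1 / 2 * Real.log t + 3) * (1 / (Real.exp (s * X) - 1)) +
      truncationError (Real.exp X) * (1 / (1 - Real.exp (-(s * X)))) ^ 2 + 1 := by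
  have h1 := shiftedLogDeriv_re_le hRH hs ht hX
  have h2 := le_of_abs_le (reLogDerivZeta_eq hRH hs ht)
  obtain ⟨h3, h4⟩ := archimedeanTerm_re_mem_Icc hs hs2 ht
  have h5 : 0 < Real.exp (s * X) - 1 := by
    have := Real.one_lt_exp_iff.2 (mul_pos hs hX)
    linarith
  have h6 : (archimedeanTerm ((1 / 2 + s : ℝ) + t * Complex.I)).re * (1 / (Real.exp (s * X) - 1)) ≤
      (1 / 2 * Real.log t + 3) * (1 / (Real.exp (s * X) - 1)) := by gcongr
  linarith

theorem reLogDerivZeta_le_of_le (hRH : RiemannHypothesis) {s s₀ t : ℝ} (hs : 0 < s)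
    (hss : s ≤ s₀) (hs2 : s₀ ≤ 2) (ht : 1 ≤ t) :
    reLogDerivZeta t s ≤
      2 * s₀ * (shiftedLogDeriv ((1 / 2 + s₀ : ℝ) + t * Complex.I)).re * (1 / s) + 1 := by
  have h1 := re_shiftedLogDeriv_le hRH hs hss (t := t)
  have h2 := le_of_abs_le (reLogDerivZeta_eq hRH hs ht)
  obtain ⟨h3, -⟩ := archimedeanTerm_re_mem_Icc hs (hss.trans hs2) ht
  have e : 2 * s₀ * (shiftedLogDeriv ((1 / 2 + s₀ : ℝ) + t * Complex.I)).re * (1 / s) =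
      2 * (s₀ / s) * (shiftedLogDeriv ((1 / 2 + s₀ : ℝ) + t * Complex.I)).re := by ring
  rw [e]
  push_cast at h1 h2 h3 ⊢
  linarith

theorem one_sub_exp_neg_pos {u : ℝ} (hu : 0 < u) : 0 < 1 - Real.exp (-u) := by
  have := Real.exp_lt_one_iff.2 (neg_neg_of_pos hu)
  linarith

theorem integral_neg_log_one_sub_exp_neg {c : ℝ} (hc : 0 < c) :
    ∫ s in Set.Ioi (0 : ℝ), -Real.log (1 - Real.exp (-(s * c))) = π ^ 2 / 6 / c := by
  set F : ℕ → ℝ → ℝ := fun n s => Real.exp ((-((n + 1) * c)) * s) / (n + 1) with hF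
  have hneg : ∀ n : ℕ, -(((n : ℝ) + 1) * c) < 0 := fun n => neg_neg_of_pos (by positivity)
  have hint : ∀ n, Integrable (F n) (volume.restrict (Set.Ioi 0)) := fun n =>
    (integrableOn_exp_mul_Ioi (hneg n) 0).div_const _
  have hval : ∀ n, ∫ s in Set.Ioi (0 : ℝ), F n s = 1 / ((n + 1 : ℕ) : ℝ) ^ 2 / c := by
    intro n
    simp only [hF]
    rw [integral_div, integral_exp_mul_Ioi (hneg n)]
    push_cast
    rw [mul_zero, Real.exp_zero]
    field_simp
  have hnorm : ∀ n, ∫ s in Set.Ioi (0 : ℝ), ‖F n s‖ = 1 / ((n + 1 : ℕ) : ℝ) ^ 2 / c := by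
    intro n
    rw [← hval n]
    refine integral_congr_ae (Filter.Eventually.of_forall fun s => ?_)
    exact Real.norm_of_nonneg (by simp only [hF]; positivity)
  have hζ : HasSum (fun n : ℕ => (1 : ℝ) / ((n + 1 : ℕ) : ℝ) ^ 2 / c) (π ^ 2 / 6 / c) := by
    have h := (hasSum_nat_add_iff' 1).2 hasSum_zeta_two
    simp only [Finset.range_one, Finset.sum_singleton, Nat.cast_zero] at h
    norm_num at h
    have := h.div_const c
    push_cast
    simpa using this
  have h1 := hasSum_integral_of_summable_integral_norm hint (by simp_rw [hnorm]; exact hζ.summable)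
  simp_rw [hval] at h1
  rw [← h1.unique hζ]
  refine setIntegral_congr_fun measurableSet_Ioi fun s hs => ?_
  have hs0 : 0 < s * c := mul_pos hs hc
  have hlt := one_sub_exp_neg_pos hs0
  have h2 := hasSum_pow_div_log_of_abs_lt_one (x := Real.exp (-(s * c)))
    (by rw [abs_of_pos (Real.exp_pos _)]; linarith)
  simp only [hF]
  rw [← h2.tsum_eq]
  refine tsum_congr fun n => ?_
  rw [← Real.exp_nat_mul]
  congr 2
  push_cast; ring

theorem integrableOn_neg_log_one_sub_exp_neg {c : ℝ} (hc : 0 < c) :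
    IntegrableOn (fun s => -Real.log (1 - Real.exp (-(s * c)))) (Set.Ioi (0 : ℝ)) := by
  refine Integrable.of_integral_ne_zero ?_
  rw [integral_neg_log_one_sub_exp_neg hc]
  positivity

theorem log_one_add_exp_neg_eq {u : ℝ} (hu : 0 < u) : Real.log (1 + Real.exp (-u)) =
    -Real.log (1 - Real.exp (-u)) - -Real.log (1 - Real.exp (-(2 * u))) := by
  have h1 := one_sub_exp_neg_pos hu
  have h2 : 1 - Real.exp (-(2 * u)) = (1 - Real.exp (-u)) * (1 + Real.exp (-u)) := by
    rw [show -(2 * u) = -u + -u by ring, Real.exp_add]; ring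
  rw [h2, Real.log_mul h1.ne' (by positivity)]
  ring

theorem integral_log_one_add_exp_neg {c : ℝ} (hc : 0 < c) :
    ∫ s in Set.Ioi (0 : ℝ), Real.log (1 + Real.exp (-(s * c))) = π ^ 2 / 12 / c := by
  have e : ∀ s ∈ Set.Ioi (0 : ℝ), Real.log (1 + Real.exp (-(s * c))) =
      -Real.log (1 - Real.exp (-(s * c))) - -Real.log (1 - Real.exp (-(s * (2 * c)))) := by
    intro s hs
    rw [log_one_add_exp_neg_eq (mul_pos hs hc), show 2 * (s * c) = s * (2 * c) by ring]
  rw [setIntegral_congr_fun measurableSet_Ioi e, integral_sub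
    (integrableOn_neg_log_one_sub_exp_neg hc)
    (integrableOn_neg_log_one_sub_exp_neg (by linarith : 0 < 2 * c)),
    integral_neg_log_one_sub_exp_neg hc, integral_neg_log_one_sub_exp_neg (by linarith)]
  field_simp
  ring

theorem integrableOn_log_one_add_exp_neg {c : ℝ} (hc : 0 < c) :
    IntegrableOn (fun s => Real.log (1 + Real.exp (-(s * c)))) (Set.Ioi (0 : ℝ)) := by
  refine Integrable.of_integral_ne_zero ?_
  rw [integral_log_one_add_exp_neg hc]
  positivity

theorem le_of_hasDerivAt_nonneg {h h' : ℝ → ℝ} {s c : ℝ} (hsc : s ≤ c)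
    (hd : ∀ r ∈ Set.Icc s c, HasDerivAt h (h' r) r) (h0 : ∀ r ∈ Set.Icc s c, 0 ≤ h' r) :
    h s ≤ h c := by
  have hm : MonotoneOn h (Set.Icc s c) := by
    refine monotoneOn_of_deriv_nonneg (convex_Icc s c)
      (fun r hr => (hd r hr).continuousAt.continuousWithinAt) ?_ ?_
    · exact fun r hr => (hd r (interior_subset hr)).differentiableAt.differentiableWithinAt
    · intro r hr
      rw [(hd r (interior_subset hr)).deriv]
      exact h0 r (interior_subset hr)
  exact hm (Set.left_mem_Icc.2 hsc) (Set.right_mem_Icc.2 hsc) hsc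

theorem hasDerivAt_log_one_add_exp_neg {c r : ℝ} :
    HasDerivAt (fun s => Real.log (1 + Real.exp (-(s * c))))
      (-(c * (1 / (Real.exp (r * c) + 1)))) r := by
  have h1 : HasDerivAt (fun s : ℝ => -(s * c)) (-(1 * c)) r := ((hasDerivAt_id r).mul_const c).neg
  convert! (h1.exp.const_add 1).log (by positivity) using 1
  rw [Real.exp_neg]
  field_simp

theorem hasDerivAt_log_one_sub_exp_neg {c r : ℝ} (hr : 0 < r) (hc : 0 < c) :
    HasDerivAt (fun s => Real.log (1 - Real.exp (-(s * c))))
      (c * (1 / (Real.exp (r * c) - 1))) r := by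
  have h1 : HasDerivAt (fun s : ℝ => -(s * c)) (-(1 * c)) r := ((hasDerivAt_id r).mul_const c).neg
  have hpos := one_sub_exp_neg_pos (mul_pos hr hc)
  have h2 : 0 < Real.exp (r * c) - 1 := by
    have := Real.one_lt_exp_iff.2 (mul_pos hr hc)
    linarith
  convert! (h1.exp.const_sub 1).log hpos.ne' using 1
  have h3 : Real.exp (-(r * c)) * Real.exp (r * c) = 1 := by rw [← Real.exp_add]; simp
  rw [mul_one_div, div_eq_div_iff h2.ne' hpos.ne']
  linear_combination -c * h3

theorem logNormZeta_le (hRH : RiemannHypothesis) {s t X : ℝ} (hs : 0 < s) (hs2 : s ≤ 2)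
    (ht : 1 ≤ t) (hX : 0 < X) :
    logNormZeta t s ≤ logNormZeta t 2 + 2 * (1 / 2 * Real.log t + 3) / X *
      Real.log (1 + Real.exp (-(s * X))) + 2 * (truncationError (Real.exp X) + 1) := by
  set b := 1 / 2 * Real.log t + 3 with hb
  set R := truncationError (Real.exp X) with hR
  have hR0 : 0 < R := truncationError_pos (Real.one_lt_exp_iff.2 hX)
  have hb0 : 0 < b := by have := Real.log_nonneg ht; rw [hb]; positivity
  have h1 := le_of_hasDerivAt_nonneg (s := s) (c := 2)
    (h := fun r => logNormZeta t r - 2 * b / X * Real.log (1 + Real.exp (-(r * X))) + (R + 1) * r)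
    (h' := fun r => reLogDerivZeta t r - 2 * b / X * (-(X * (1 / (Real.exp (r * X) + 1)))) +
      (R + 1) * 1) hs2
    (fun r hr => ((hasDerivAt_logNormZeta hRH (by linarith [hr.1]) (by linarith)).sub
      (hasDerivAt_log_one_add_exp_neg.const_mul _)).add ((hasDerivAt_id r).const_mul _))
    (fun r hr => by
      have := neg_le_reLogDerivZeta hRH (by linarith [hr.1] : 0 < r) hr.2 ht hX
      rw [← hb, ← hR] at this
      have e : 2 * b / X * (-(X * (1 / (Real.exp (r * X) + 1)))) =
        -(2 * b * (1 / (Real.exp (r * X) + 1))) := by field_simp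
      rw [e]
      linarith)
  have h2 : 0 ≤ 2 * b / X * Real.log (1 + Real.exp (-(2 * X))) :=
    mul_nonneg (by positivity) (Real.log_nonneg (by linarith [Real.exp_pos (-(2 * X))]))
  have h3 : 0 ≤ (R + 1) * s := by positivity
  linarith

theorem inv_one_sub_exp_neg_sq_le {u : ℝ} (hu : 0 < u) :
    (1 / (1 - Real.exp (-u))) ^ 2 ≤ 2 + 2 * (1 / u) ^ 2 := by
  have h1 := one_sub_exp_neg_pos hu
  have h2 : 1 / (1 - Real.exp (-u)) ≤ 1 + 1 / u := by
    rw [div_le_iff₀ h1]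
    have h3 : (u + 1) * Real.exp (-u) ≤ 1 := by
      have := Real.add_one_le_exp u
      have h4 : Real.exp u * Real.exp (-u) = 1 := by rw [← Real.exp_add]; simp
      nlinarith [Real.exp_pos (-u)]
    have e : (1 + 1 / u) * (1 - Real.exp (-u)) = ((u + 1) - (u + 1) * Real.exp (-u)) / u := by
      field_simp
    rw [e, le_div_iff₀ hu]
    linarith
  have h5 : 0 < 1 / (1 - Real.exp (-u)) := by positivity
  nlinarith [sq_nonneg (1 - 1 / u)]

theorem le_logNormZeta (hRH : RiemannHypothesis) {s t X : ℝ} (hs : 0 < s) (hs2 : s ≤ 2)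
    (ht : 1 ≤ t) (hX : 0 < X) :
    logNormZeta t 2 + 2 * (1 / 2 * Real.log t + 3) / X * Real.log (1 - Real.exp (-(s * X))) -
      truncationError (Real.exp X) * (4 + 2 / X ^ 2 * (1 / s)) - 2 ≤ logNormZeta t s := by
  set b := 1 / 2 * Real.log t + 3 with hb
  set R := truncationError (Real.exp X) with hR
  have hR0 : 0 < R := truncationError_pos (Real.one_lt_exp_iff.2 hX)
  have hb0 : 0 < b := by have := Real.log_nonneg ht; rw [hb]; positivity
  have h1 := le_of_hasDerivAt_nonneg (s := s) (c := 2)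
    (h := fun r => 2 * b / X * Real.log (1 - Real.exp (-(r * X))) +
      R * (2 * r - 2 / X ^ 2 * r⁻¹) + r - logNormZeta t r)
    (h' := fun r => 2 * b / X * (X * (1 / (Real.exp (r * X) - 1))) +
      R * (2 * 1 - 2 / X ^ 2 * (-(r ^ 2)⁻¹)) + 1 - reLogDerivZeta t r) hs2
    (fun r hr => by
      have hr0 : 0 < r := by linarith [hr.1]
      exact ((((hasDerivAt_log_one_sub_exp_neg hr0 hX).const_mul _).add
        ((((hasDerivAt_id r).const_mul 2).sub ((hasDerivAt_inv hr0.ne').const_mul _)).const_mul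
          R)).add (hasDerivAt_id r)).sub (hasDerivAt_logNormZeta hRH hr0 (by linarith)))
    (fun r hr => by
      have hr0 : 0 < r := by linarith [hr.1]
      have h2 := reLogDerivZeta_le hRH hr0 hr.2 ht hX
      rw [← hb, ← hR] at h2
      have e : 2 * b / X * (X * (1 / (Real.exp (r * X) - 1))) =
        2 * b * (1 / (Real.exp (r * X) - 1)) := by field_simp
      have h3 := mul_le_mul_of_nonneg_left (inv_one_sub_exp_neg_sq_le (mul_pos hr0 hX)) hR0.le
      have e2 : 2 * 1 - 2 / X ^ 2 * (-(r ^ 2)⁻¹) = 2 + 2 * (1 / (r * X)) ^ 2 := by field_simp; ring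
      rw [e, e2]
      linarith)
  have h2 : Real.log (1 - Real.exp (-(2 * X))) ≤ 0 :=
    Real.log_nonpos (one_sub_exp_neg_pos (by linarith)).le (by linarith [Real.exp_pos (-(2 * X))])
  have h3 := mul_nonneg (by positivity : 0 ≤ 2 * b / X) (neg_nonneg.2 h2)
  have h4 : 0 ≤ R * (2 * s) := by positivity
  have h5 : 0 ≤ R * (2 / X ^ 2 * (2 : ℝ)⁻¹) := by positivity
  rw [one_div]
  nlinarith

theorem le_logNormZeta_of_le (hRH : RiemannHypothesis) {s s₀ t : ℝ} (hs : 0 < s)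
    (hss : s ≤ s₀) (hs2 : s₀ ≤ 2) (ht : 1 ≤ t) :
    logNormZeta t s₀ + 2 * s₀ * (shiftedLogDeriv ((1 / 2 + s₀ : ℝ) + t * Complex.I)).re *
      (Real.log s - Real.log s₀) - s₀ ≤ logNormZeta t s := by
  set F := (shiftedLogDeriv ((1 / 2 + s₀ : ℝ) + t * Complex.I)).re
  have h1 := le_of_hasDerivAt_nonneg (s := s) (c := s₀)
    (h := fun r => 2 * s₀ * F * Real.log r + r - logNormZeta t r)
    (h' := fun r => 2 * s₀ * F * (1 / r) + 1 - reLogDerivZeta t r) hss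
    (fun r hr => by
      have hr0 : 0 < r := by linarith [hr.1]
      have hl : HasDerivAt Real.log (1 / r) r := by
        rw [one_div]; exact Real.hasDerivAt_log hr0.ne'
      exact ((hl.const_mul _).add (hasDerivAt_id r)).sub
        (hasDerivAt_logNormZeta hRH hr0 (by linarith)))
    (fun r hr => by
      have := reLogDerivZeta_le_of_le hRH (by linarith [hr.1] : 0 < r) hr.2 hs2 ht
      linarith)
  linarith

/-- At a distance `1 / X ^ 2` from the critical line. -/
theorem shiftedLogDeriv_re_le_near_line (hRH : RiemannHypothesis) {t X : ℝ} (ht : 1 ≤ t)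
    (hX : 1 ≤ X) :
    (shiftedLogDeriv ((1 / 2 + 1 / X ^ 2 : ℝ) + t * Complex.I)).re ≤
      3 * X * (1 / 2 * Real.log t + 3) + 4 * X ^ 2 * truncationError (Real.exp X) := by
  have hX0 : 0 < X := by linarith
  have hs : 0 < 1 / X ^ 2 := by positivity
  have hs2 : 1 / X ^ 2 ≤ 1 := by
    rw [div_le_one (by positivity)]; nlinarith
  have h1 := shiftedLogDeriv_re_le hRH hs ht hX0
  have e : 1 / X ^ 2 * X = 1 / X := by field_simp
  rw [e] at h1
  obtain ⟨h3, h4⟩ := archimedeanTerm_re_mem_Icc hs (by linarith) ht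
  have hR0 := truncationError_pos (Real.one_lt_exp_iff.2 hX0)
  have h5 := inv_one_sub_exp_neg_sq_le (by positivity : 0 < 1 / X)
  rw [one_div_one_div] at h5
  have h6 : 1 / (Real.exp (1 / X) - 1) ≤ X := by
    have := Real.add_one_le_exp (1 / X)
    have hp : 0 < 1 / X := by positivity
    calc 1 / (Real.exp (1 / X) - 1) ≤ 1 / (1 / X) :=
          one_div_le_one_div_of_le hp (by linarith)
      _ = X := one_div_one_div X
  have h7 : (archimedeanTerm ((1 / 2 + 1 / X ^ 2 : ℝ) + t * Complex.I)).re *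
      (1 + 2 * (1 / (Real.exp (1 / X) - 1))) ≤ (1 / 2 * Real.log t + 3) * (3 * X) := by
    refine (mul_le_mul_of_nonneg_left (by linarith) h3).trans
      (mul_le_mul_of_nonneg_right h4 (by linarith))
  have h8 : truncationError (Real.exp X) * (1 / (1 - Real.exp (-(1 / X)))) ^ 2 ≤
      truncationError (Real.exp X) * (4 * X ^ 2) :=
    mul_le_mul_of_nonneg_left (h5.trans (by nlinarith)) hR0.le
  linarith

theorem analyticAt_riemannZeta {z : ℂ} (hz : z ≠ 1) : AnalyticAt ℂ riemannZeta z :=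
  analyticOn_riemannZeta z hz

theorem intervalIntegrable_logNormZeta {t : ℝ} (ht : t ≠ 0) (a b : ℝ) :
    IntervalIntegrable (logNormZeta t) volume a b := by
  refine MeromorphicOn.intervalIntegrable_log_norm
    (f := fun s : ℝ => riemannZeta ((1 / 2 + s : ℝ) + t * Complex.I)) fun s _ => ?_
  have h1 : AnalyticAt ℝ (fun s : ℝ => ((1 / 2 + s : ℝ) : ℂ) + t * Complex.I) s := by
    have h : AnalyticAt ℝ (fun s : ℝ => (s : ℂ)) s := Complex.ofRealCLM.analyticAt s
    have e : (fun s : ℝ => ((1 / 2 + s : ℝ) : ℂ) + t * Complex.I) =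
        fun s : ℝ => (s : ℂ) + (1 / 2 + t * Complex.I) := by
      funext s; push_cast; ring
    rw [e]
    exact h.add analyticAt_const
  have h2 : AnalyticAt ℝ riemannZeta (((1 / 2 + s : ℝ) : ℂ) + t * Complex.I) :=
    (analyticAt_riemannZeta (ne_one_of_im_ne_zero ht)).restrictScalars
  exact (AnalyticAt.comp (g := riemannZeta)
    (f := fun s : ℝ => ((1 / 2 + s : ℝ) : ℂ) + t * Complex.I) h2 h1).meromorphicAt

theorem abs_logNormZeta_le {s t : ℝ} (hs : 3 / 2 ≤ s) :
    |logNormZeta t s| ≤ 2 * 2 ^ (3 / 2 - s) := by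
  have h := abs_log_norm_zeta_le (z := (1 / 2 + s : ℝ) + t * Complex.I) (by simp; linarith)
  have e : (2 : ℝ) - (((1 / 2 + s : ℝ) : ℂ) + t * Complex.I).re = 3 / 2 - s := by simp; ring
  rwa [e] at h

theorem abs_logNormZeta_two_le (t : ℝ) : |logNormZeta t 2| ≤ 2 := by
  refine (abs_logNormZeta_le (by norm_num)).trans ?_
  have : (2 : ℝ) ^ (3 / 2 - 2 : ℝ) ≤ 1 :=
    Real.rpow_le_one_of_one_le_of_nonpos (by norm_num) (by norm_num)
  linarith

theorem integral_logNormZeta_le (hRH : RiemannHypothesis) {t X : ℝ} (ht : 1 ≤ t) (hX : 0 < X) :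
    ∫ s in (0 : ℝ)..2, logNormZeta t s ≤
      (Real.log t + 6) * (π ^ 2 / 12) / X ^ 2 + 4 * truncationError (Real.exp X) + 8 := by
  set b := 1 / 2 * Real.log t + 3 with hb
  set R := truncationError (Real.exp X) with hR
  have hb0 : 0 < b := by have := Real.log_nonneg ht; rw [hb]; positivity
  have hi : IntervalIntegrable (fun s => Real.log (1 + Real.exp (-(s * X)))) volume 0 2 :=
    (intervalIntegrable_iff_integrableOn_Ioc_of_le (by norm_num)).2
      ((integrableOn_log_one_add_exp_neg hX).mono_set Set.Ioc_subset_Ioi_self)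
  have h1 : ∫ s in (0 : ℝ)..2, logNormZeta t s ≤ ∫ s in (0 : ℝ)..2, (2 + 2 * (R + 1) +
      2 * b / X * Real.log (1 + Real.exp (-(s * X)))) := by
    refine intervalIntegral.integral_mono_on_of_le_Ioo (by norm_num)
      (intervalIntegrable_logNormZeta (by linarith) _ _)
      ((intervalIntegrable_const).add (hi.const_mul _)) fun s hs => ?_
    have h := logNormZeta_le hRH hs.1 hs.2.le ht hX
    have h2 := le_of_abs_le (abs_logNormZeta_two_le t)
    rw [← hb, ← hR] at h
    linarith
  rw [intervalIntegral.integral_add intervalIntegrable_const (hi.const_mul _),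
    intervalIntegral.integral_const, intervalIntegral.integral_const_mul] at h1
  have h2 : ∫ s in (0 : ℝ)..2, Real.log (1 + Real.exp (-(s * X))) ≤ π ^ 2 / 12 / X := by
    rw [← integral_log_one_add_exp_neg hX, intervalIntegral.integral_of_le (by norm_num)]
    refine setIntegral_mono_set (integrableOn_log_one_add_exp_neg hX) ?_
      Set.Ioc_subset_Ioi_self.eventuallyLE
    exact Filter.Eventually.of_forall fun s =>
      Real.log_nonneg (by linarith [Real.exp_pos (-(s * X))])
  have h3 := mul_le_mul_of_nonneg_left h2 (by positivity : 0 ≤ 2 * b / X)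
  have e : 2 * b / X * (π ^ 2 / 12 / X) = (Real.log t + 6) * (π ^ 2 / 12) / X ^ 2 := by
    rw [hb]; field_simp; ring
  rw [e] at h3
  rw [smul_eq_mul] at h1
  linarith

theorem neg_log_two_mul_le {X : ℝ} (hX : 1 ≤ X) :
    -Real.log (2 * X) ≤ Real.log (1 - Real.exp (-(1 / X))) := by
  have hX0 : 0 < X := by linarith
  rw [← Real.log_inv]
  refine Real.log_le_log (by positivity) ?_
  have h1 := Real.add_one_le_exp (1 / X)
  have h2 : Real.exp (-(1 / X)) ≤ 1 / (1 / X + 1) := by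
    rw [Real.exp_neg, ← one_div]
    exact one_div_le_one_div_of_le (by positivity) h1
  have h3 : (2 * X)⁻¹ ≤ 1 - 1 / (1 / X + 1) := by
    have e : 1 - 1 / (1 / X + 1) = (X + 1)⁻¹ := by field_simp; ring
    rw [e]
    exact inv_anti₀ (by positivity) (by linarith)
  linarith

theorem le_integral_logNormZeta_near_line (hRH : RiemannHypothesis) {t X : ℝ} (ht : 1 ≤ t)
    (hX : 1 ≤ X) :
    -((Real.log t + 6) * (Real.log (2 * X) + 3) / X ^ 3) - 14 * truncationError (Real.exp X) - 5 ≤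
      ∫ s in (0 : ℝ)..1 / X ^ 2, logNormZeta t s := by
  have hX0 : 0 < X := by linarith
  set b := 1 / 2 * Real.log t + 3 with hb
  set R := truncationError (Real.exp X) with hR
  set s₀ := 1 / X ^ 2 with hs₀
  set F := (shiftedLogDeriv ((1 / 2 + s₀ : ℝ) + t * Complex.I)).re with hF
  have hR0 : 0 < R := truncationError_pos (Real.one_lt_exp_iff.2 hX0)
  have hb0 : 0 < b := by have := Real.log_nonneg ht; rw [hb]; positivity
  have hs0 : 0 < s₀ := by positivity
  have hs1 : s₀ ≤ 1 := by rw [hs₀, div_le_one (by positivity)]; nlinarith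
  have hlog : IntervalIntegrable Real.log volume 0 s₀ := intervalIntegral.intervalIntegrable_log'
  have h1 : ∫ s in (0 : ℝ)..s₀, ((logNormZeta t s₀ - s₀ - 2 * s₀ * F * Real.log s₀) +
      2 * s₀ * F * Real.log s) ≤ ∫ s in (0 : ℝ)..s₀, logNormZeta t s := by
    refine intervalIntegral.integral_mono_on_of_le_Ioo hs0.le
      (intervalIntegrable_const.add (hlog.const_mul _))
      (intervalIntegrable_logNormZeta (by linarith) _ _) fun s hs => ?_
    have h := le_logNormZeta_of_le hRH hs.1 hs.2.le (by linarith) ht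
    rw [← hF] at h
    linarith
  rw [intervalIntegral.integral_add intervalIntegrable_const (hlog.const_mul _),
    intervalIntegral.integral_const, intervalIntegral.integral_const_mul, integral_log,
    smul_eq_mul] at h1
  have h2 := le_logNormZeta hRH hs0 (by linarith) ht hX0
  have h3 := (abs_le.1 (abs_logNormZeta_two_le t)).1
  have h4 := shiftedLogDeriv_re_le_near_line hRH ht hX
  have e1 : s₀ * X = 1 / X := by rw [hs₀]; field_simp
  have e2 : 2 / X ^ 2 * (1 / s₀) = 2 := by rw [hs₀]; field_simp
  rw [e1, e2, ← hb, ← hR] at h2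
  rw [← hb, ← hR, ← hs₀, ← hF] at h4
  have h5 := mul_le_mul_of_nonneg_left (neg_log_two_mul_le hX) (by positivity : 0 ≤ 2 * b / X)
  have h6 : s₀ * F ≤ 3 * b / X + 4 * R := by
    have := mul_le_mul_of_nonneg_left h4 hs0.le
    have e : s₀ * (3 * X * b + 4 * X ^ 2 * R) = 3 * b / X + 4 * R := by
      rw [hs₀]; field_simp
    rwa [e] at this
  have h7 : s₀ * (s₀ * F) ≤ s₀ * (3 * b / X) + 4 * R := by
    have := mul_le_mul_of_nonneg_left h6 hs0.le
    nlinarith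
  have h8 : s₀ * (-(2 * b / X * Real.log (2 * X))) - 6 * R - 4 ≤ s₀ * logNormZeta t s₀ := by
    have h9 : -(2 * b / X * Real.log (2 * X)) - 6 * R - 4 ≤ logNormZeta t s₀ := by linarith
    have := mul_le_mul_of_nonneg_left h9 hs0.le
    nlinarith
  have e3 : (Real.log t + 6) * (Real.log (2 * X) + 3) / X ^ 3 =
      s₀ * (2 * b / X * Real.log (2 * X)) + 2 * (s₀ * (3 * b / X)) := by
    rw [hs₀, hb]; field_simp; ring
  rw [e3]
  have h10 : s₀ * s₀ ≤ 1 := mul_le_one₀ hs1 hs0.le hs1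
  simp only [sub_zero, Real.log_zero, mul_zero] at h1
  nlinarith

theorem le_integral_logNormZeta (hRH : RiemannHypothesis) {t X : ℝ} (ht : 1 ≤ t) (hX : 1 ≤ X) :
    -((Real.log t + 6) * (π ^ 2 / 6) / X ^ 2) -
      (Real.log t + 6) * (Real.log (2 * X) + 3) / X ^ 3 -
      26 * truncationError (Real.exp X) - 13 ≤ ∫ s in (0 : ℝ)..2, logNormZeta t s := by
  have hX0 : 0 < X := by linarith
  have h0 := le_integral_logNormZeta_near_line hRH ht hX
  set b := 1 / 2 * Real.log t + 3 with hb
  set R := truncationError (Real.exp X) with hR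
  set s₀ := 1 / X ^ 2 with hs₀
  have hR0 : 0 < R := truncationError_pos (Real.one_lt_exp_iff.2 hX0)
  have hb0 : 0 < b := by have := Real.log_nonneg ht; rw [hb]; positivity
  have hs0 : 0 < s₀ := by positivity
  have hs1 : s₀ ≤ 1 := by rw [hs₀, div_le_one (by positivity)]; nlinarith
  have hi : IntervalIntegrable (fun s => -Real.log (1 - Real.exp (-(s * X)))) volume s₀ 2 :=
    (intervalIntegrable_iff_integrableOn_Ioc_of_le (by linarith)).2
      ((integrableOn_neg_log_one_sub_exp_neg hX0).mono_set
        (Set.Ioc_subset_Ioi_self.trans (Set.Ioi_subset_Ioi hs0.le)))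
  have h0mem : (0 : ℝ) ∉ Set.uIcc s₀ 2 := by
    rw [Set.uIcc_of_le (by linarith)]
    exact fun h => absurd h.1 (by linarith)
  have hj : IntervalIntegrable (fun s : ℝ => 1 / s) volume s₀ 2 :=
    intervalIntegral.intervalIntegrable_one_div (fun s hs => by
      rintro rfl; exact h0mem hs) continuousOn_id
  have h1 : ∫ s in s₀..2, ((-4 - 4 * R) + -(2 * b / X) * (-Real.log (1 - Real.exp (-(s * X)))) +
      -(2 * R / X ^ 2) * (1 / s)) ≤ ∫ s in s₀..2, logNormZeta t s := by
    refine intervalIntegral.integral_mono_on_of_le_Ioo (by linarith)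
      ((intervalIntegrable_const.add (hi.const_mul _)).add (hj.const_mul _))
      (intervalIntegrable_logNormZeta (by linarith) _ _) fun s hs => ?_
    have h := le_logNormZeta hRH (hs0.trans hs.1) hs.2.le ht hX0
    have h3 := (abs_le.1 (abs_logNormZeta_two_le t)).1
    rw [← hb, ← hR] at h
    have e : R * (4 + 2 / X ^ 2 * (1 / s)) = 4 * R + 2 * R / X ^ 2 * (1 / s) := by ring
    rw [e] at h
    linarith
  rw [intervalIntegral.integral_add (intervalIntegrable_const.add (hi.const_mul _))
      (hj.const_mul _), intervalIntegral.integral_add intervalIntegrable_const (hi.const_mul _),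
    intervalIntegral.integral_const, intervalIntegral.integral_const_mul,
    intervalIntegral.integral_const_mul, integral_one_div h0mem, smul_eq_mul] at h1
  have h2 : ∫ s in s₀..2, -Real.log (1 - Real.exp (-(s * X))) ≤ π ^ 2 / 6 / X := by
    rw [← integral_neg_log_one_sub_exp_neg hX0, intervalIntegral.integral_of_le (by linarith)]
    refine setIntegral_mono_set (integrableOn_neg_log_one_sub_exp_neg hX0) ?_
      (Set.Ioc_subset_Ioi_self.trans (Set.Ioi_subset_Ioi hs0.le)).eventuallyLE
    refine (ae_restrict_iff' measurableSet_Ioi).2 (Filter.Eventually.of_forall fun s hs => ?_)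
    have hsX : 0 < s * X := mul_pos hs hX0
    exact neg_nonneg.2 (Real.log_nonpos (one_sub_exp_neg_pos hsX).le
      (by linarith [Real.exp_pos (-(s * X))]))
  have h3 := mul_le_mul_of_nonneg_left h2 (by positivity : 0 ≤ 2 * b / X)
  have e : 2 * b / X * (π ^ 2 / 6 / X) = (Real.log t + 6) * (π ^ 2 / 6) / X ^ 2 := by
    rw [hb]; field_simp; ring
  rw [e] at h3
  have h4 : 2 * R / X ^ 2 * Real.log (2 / s₀) ≤ 4 * R := by
    have h5 : 2 / s₀ = 2 * X ^ 2 := by rw [hs₀]; field_simp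
    have h6 := Real.log_le_self (by positivity : 0 ≤ 2 * X ^ 2)
    rw [h5]
    have := mul_le_mul_of_nonneg_left h6 (by positivity : 0 ≤ 2 * R / X ^ 2)
    have e7 : 2 * R / X ^ 2 * (2 * X ^ 2) = 4 * R := by field_simp; ring
    linarith
  have h7 : (2 - s₀) * (-4 - 4 * R) ≥ 2 * (-4 - 4 * R) := by nlinarith
  rw [← intervalIntegral.integral_add_adjacent_intervals
    (intervalIntegrable_logNormZeta (t := t) (by linarith) 0 s₀)
    (intervalIntegrable_logNormZeta (by linarith) s₀ 2)]
  linarith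

theorem integrableAtFilter_of_neg_one_le_meromorphicOrderAt {f : ℂ → ℂ} {z₀ : ℂ}
    (hf : MeromorphicAt f z₀) (ho : -1 ≤ meromorphicOrderAt f z₀) (hm : Measurable f) :
    IntegrableAtFilter f (nhds z₀) volume := by
  have hs : MeromorphicAt (fun z => z - z₀) z₀ := by fun_prop
  have hp : MeromorphicAt ((fun z => z - z₀) * f) z₀ := hs.mul hf
  have hpo : 0 ≤ meromorphicOrderAt ((fun z => z - z₀) * f) z₀ := by
    rw [meromorphicOrderAt_mul hs hf, meromorphicOrderAt_id_sub_const]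
    calc (0 : WithTop ℤ) = 1 + (-1) := by rfl
      _ ≤ 1 + meromorphicOrderAt f z₀ := by gcongr
  obtain ⟨c, hc⟩ := tendsto_nhds_of_meromorphicOrderAt_nonneg hp hpo
  have hb : ∀ᶠ z in nhdsWithin z₀ {z₀}ᶜ, ‖((fun z => z - z₀) * f) z‖ < ‖c‖ + 1 :=
    hc.norm.eventually_lt_const (by linarith)
  rw [eventually_nhdsWithin_iff, Metric.eventually_nhds_iff] at hb
  obtain ⟨r, hr, hb⟩ := hb
  refine ⟨Metric.ball z₀ r, Metric.ball_mem_nhds _ hr, ?_⟩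
  have h0 : IntegrableOn (fun z => f (z + z₀)) (Metric.ball 0 r) := by
    refine integrableOn_ball_of_norm_le_rpow (C := ‖c‖ + 1) (α := 1) (by simp) (by simp) ?_
      (hm.comp (measurable_id.add_const z₀)).aestronglyMeasurable
    have hae : ∀ᵐ z : ℂ ∂volume.restrict (Metric.ball 0 r), z ≠ 0 :=
      ae_restrict_of_ae (by simp [ae_iff])
    filter_upwards [hae, ae_restrict_mem Metric.isOpen_ball.measurableSet] with z hz hzr
    have h := hb (y := z + z₀) (by simpa using hzr) (by simpa using hz)
    simp only [Pi.mul_apply, add_sub_cancel_right, norm_mul] at h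
    rw [Real.rpow_neg_one, ← div_eq_mul_inv, le_div_iff₀ (norm_pos_iff.2 hz)]
    linarith
  have hmp : MeasurePreserving (fun z : ℂ => z + -z₀) volume volume :=
    measurePreserving_add_right _ _
  have h1 := (hmp.integrableOn_comp_preimage (measurableEmbedding_addRight (-z₀))).2 h0
  convert! h1 using 1
  · funext z; simp
  · ext z; simp [dist_eq_norm, sub_eq_add_neg]

theorem not_eventually_riemannZeta_eq_zero {z₀ : ℂ} (h : z₀ ≠ 1) :
    ¬ ∀ᶠ z in nhds z₀, riemannZeta z = 0 := by
  intro h0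
  have hc : IsPreconnected ({1}ᶜ : Set ℂ) :=
    (isConnected_compl_singleton_of_one_lt_rank (by simp) 1).isPreconnected
  have h2 := AnalyticOnNhd.eqOn_zero_of_preconnected_of_eventuallyEq_zero
    (fun _ hz => analyticAt_riemannZeta hz) hc (show z₀ ∈ ({1}ᶜ : Set ℂ) from h) h0
    (x := 2)
  have h3 : (2 : ℂ) ∈ ({1}ᶜ : Set ℂ) := by simp
  exact riemannZeta_ne_zero_of_one_le_re (s := 2) (by simp) (h2 h3)

theorem measurable_riemannZeta : Measurable riemannZeta :=
  measurable_of_continuousOn_compl_singleton 1 fun _ hz =>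
    (analyticAt_riemannZeta hz).continuousAt.continuousWithinAt

theorem measurable_logDeriv_riemannZeta : Measurable (logDeriv riemannZeta) :=
  (measurable_deriv _).div measurable_riemannZeta

theorem integrableAtFilter_logDeriv_riemannZeta {z₀ : ℂ} (h : z₀ ≠ 1) :
    IntegrableAtFilter (logDeriv riemannZeta) (nhds z₀) volume := by
  have ha := analyticAt_riemannZeta h
  refine integrableAtFilter_of_neg_one_le_meromorphicOrderAt ha.meromorphicAt.logDeriv ?_
    measurable_logDeriv_riemannZeta
  have ht : meromorphicOrderAt riemannZeta z₀ ≠ ⊤ := by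
    rw [ha.meromorphicOrderAt_eq]
    simpa [analyticOrderAt_eq_top] using not_eventually_riemannZeta_eq_zero h
  by_cases h0 : meromorphicOrderAt riemannZeta z₀ = 0
  · exact le_trans (by decide) (meromorphicOrderAt_logDeriv_nonneg ha.meromorphicAt h0)
  · exact (meromorphicOrderAt_logDeriv_eq_neg_one ha.meromorphicAt h0 ht).ge

theorem integrableOn_logDeriv_riemannZeta {K : Set ℂ} (hK : IsCompact K) (h1 : 1 ∉ K) :
    IntegrableOn (logDeriv riemannZeta) K :=
  LocallyIntegrableOn.integrableOn_isCompact
    (fun _ hz => (integrableAtFilter_logDeriv_riemannZeta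
      (fun h => h1 (h ▸ hz))).filter_mono nhdsWithin_le_nhds) hK

theorem integrableOn_logDeriv_riemannZeta_rectangle {a b c d : ℝ} (hc : 0 < c) :
    IntegrableOn (fun p : ℝ × ℝ => logDeriv riemannZeta (p.1 + p.2 * Complex.I))
      (Set.Icc a b ×ˢ Set.Icc c d) (volume.prod volume) := by
  have hK : IsCompact (Set.Icc a b ×ℂ Set.Icc c d) := isCompact_Icc.reProdIm isCompact_Icc
  have h := integrableOn_logDeriv_riemannZeta hK (by
    intro h; have := h.2; simp at this; linarith [this.1])
  rw [← (Complex.volume_preserving_equiv_real_prod.symm _).integrableOn_comp_preimage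
    (MeasurableEquiv.measurableEmbedding _)] at h
  convert! h using 1
  funext p
  refine congrArg (logDeriv riemannZeta) ?_
  apply Complex.ext <;> simp [Complex.measurableEquivRealProd]

theorem integrableOn_logDeriv_riemannZeta_strip {a b t : ℝ} (ha : 0 < a) :
    IntegrableOn (fun p : ℝ × ℝ => logDeriv riemannZeta (p.1 + p.2 * Complex.I))
      (Set.Ioi b ×ˢ Set.Ioc a t) (volume.prod volume) := by
  set F := fun p : ℝ × ℝ => logDeriv riemannZeta (p.1 + p.2 * Complex.I) with hF
  have hsub : Set.Ioi b ×ˢ Set.Ioc a t ⊆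
      Set.Icc b 2 ×ˢ Set.Icc a t ∪ Set.Ioi (2 : ℝ) ×ˢ Set.Ioc a t := by
    rintro ⟨x, y⟩ ⟨hx, hy⟩
    rcases le_or_gt x 2 with h | h
    · exact Or.inl ⟨⟨le_of_lt hx, h⟩, Set.Ioc_subset_Icc_self hy⟩
    · exact Or.inr ⟨h, hy⟩
  refine IntegrableOn.mono_set (integrableOn_union.2
    ⟨integrableOn_logDeriv_riemannZeta_rectangle ha, ?_⟩) hsub
  have hm : Measurable F := measurable_logDeriv_riemannZeta.comp (by fun_prop)
  have hg : Integrable (fun p : ℝ × ℝ => vonMangoldtTwo * 2 ^ (2 - p.1) * 1)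
      ((volume.restrict (Set.Ioi (2 : ℝ))).prod (volume.restrict (Set.Ioc a t))) := by
    refine Integrable.mul_prod (f := fun x : ℝ => vonMangoldtTwo * 2 ^ (2 - x))
      (g := fun _ => (1 : ℝ)) (Integrable.const_mul ?_ _) (integrable_const _)
    have e : (fun x : ℝ => (2 : ℝ) ^ (2 - x)) = fun x => 4 * Real.exp (-Real.log 2 * x) := by
      funext x
      rw [Real.rpow_sub (by norm_num), Real.rpow_def_of_pos (by norm_num) x, neg_mul,
        Real.exp_neg]
      norm_num [div_eq_mul_inv]
    rw [e]
    exact (exp_neg_integrableOn_Ioi 2 (Real.log_pos (by norm_num))).const_mul _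
  rw [IntegrableOn, ← Measure.prod_restrict]
  refine hg.mono' hm.aestronglyMeasurable ?_
  rw [Measure.prod_restrict]
  filter_upwards [ae_restrict_mem (measurableSet_Ioi.prod measurableSet_Ioc)] with p hp
  have h := norm_logDeriv_zeta_le (z := p.1 + p.2 * Complex.I) (by simpa using le_of_lt hp.1)
  simp only [hF, logDeriv_apply]
  simpa using h

theorem integral_im_logDeriv_riemannZeta (hRH : RiemannHypothesis) {σ a t : ℝ} (hσ : 1 / 2 < σ)
    (ha : 0 < a) (hat : a ≤ t) :
    ∫ u in Set.Ioc a t, (logDeriv riemannZeta (σ + u * Complex.I)).im =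
      logNormZeta a (σ - 1 / 2) - logNormZeta t (σ - 1 / 2) := by
  have h1 : ∀ u ∈ Set.uIcc a t, (σ : ℂ) + u * Complex.I ≠ 1 := fun u hu =>
    ne_one_of_im_ne_zero (by rw [Set.uIcc_of_le hat] at hu; linarith [hu.1])
  have h0 : ∀ u ∈ Set.uIcc a t, riemannZeta (σ + u * Complex.I) ≠ 0 := fun u hu =>
    riemannZeta_ne_zero_of_half_lt hRH (by simpa using hσ) (h1 u hu)
  have hd : ∀ u ∈ Set.uIcc a t, HasDerivAt
      (fun u : ℝ => -Real.log ‖riemannZeta ((σ : ℂ) + u * Complex.I)‖)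
      (logDeriv riemannZeta (σ + u * Complex.I)).im u := by
    intro u hu
    have hz := (analyticAt_riemannZeta (h1 u hu)).differentiableAt.hasDerivAt
    have hl : HasDerivAt (fun u : ℝ => (σ : ℂ) + u * Complex.I) Complex.I u := by
      simpa using ((Complex.ofRealCLM.hasDerivAt (x := u)).mul_const Complex.I).const_add (σ : ℂ)
    have hc := HasDerivAt.comp u hz hl
    convert! (hasDerivAt_log_norm hc (h0 u hu)).neg using 1
    rw [logDeriv_apply, mul_div_right_comm]
    simp
  have hcont : ContinuousOn (fun u : ℝ => (logDeriv riemannZeta (σ + u * Complex.I)).im)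
      (Set.uIcc a t) := by
    intro u hu
    have hz := analyticAt_riemannZeta (h1 u hu)
    have hz' : ContinuousAt (logDeriv riemannZeta) ((σ : ℂ) + u * Complex.I) :=
      hz.deriv.continuousAt.div hz.continuousAt (h0 u hu)
    have hl : ContinuousAt (fun u : ℝ => (σ : ℂ) + u * Complex.I) u := by fun_prop
    exact (Complex.continuous_im.continuousAt.comp
      (ContinuousAt.comp (f := fun u : ℝ => (σ : ℂ) + u * Complex.I) hz' hl)).continuousWithinAt
  rw [← intervalIntegral.integral_of_le hat,
    intervalIntegral.integral_eq_sub_of_hasDerivAt hd hcont.intervalIntegrable]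
  simp only [logNormZeta]
  have e : (1 / 2 + (σ - 1 / 2) : ℝ) = σ := by ring
  rw [e]
  ring

theorem integrableOn_logNormZeta_Ioi_two (t : ℝ) :
    IntegrableOn (logNormZeta t) (Set.Ioi 2) := by
  have hm : Measurable (logNormZeta t) := by
    unfold logNormZeta
    exact Real.measurable_log.comp (measurable_riemannZeta.comp (by fun_prop)).norm
  refine Integrable.mono' (g := fun s => 2 * Real.exp 2 * Real.exp (-Real.log 2 * s))
    ((exp_neg_integrableOn_Ioi 2 (Real.log_pos (by norm_num))).const_mul _)
    hm.aestronglyMeasurable ?_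
  filter_upwards [ae_restrict_mem measurableSet_Ioi] with s hs
  have hs' : (2 : ℝ) < s := hs
  refine (abs_logNormZeta_le (by linarith)).trans ?_
  rw [Real.rpow_def_of_pos (by norm_num), mul_assoc, ← Real.exp_add]
  gcongr
  nlinarith [Real.log_two_lt_d9]

theorem abs_integral_logNormZeta_Ioi_two_le (t : ℝ) :
    |∫ s in Set.Ioi 2, logNormZeta t s| ≤
      ∫ s in Set.Ioi 2, 2 * Real.exp 2 * Real.exp (-Real.log 2 * s) := by
  rw [← Real.norm_eq_abs]
  refine norm_integral_le_of_norm_le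
    ((exp_neg_integrableOn_Ioi 2 (Real.log_pos (by norm_num))).const_mul _) ?_
  filter_upwards [ae_restrict_mem measurableSet_Ioi] with s hs
  have hs' : (2 : ℝ) < s := hs
  refine (abs_logNormZeta_le (by linarith)).trans ?_
  rw [Real.rpow_def_of_pos (by norm_num), mul_assoc, ← Real.exp_add]
  gcongr
  nlinarith [Real.log_two_lt_d9]

theorem integrableOn_logNormZeta_Ioi_zero {t : ℝ} (ht : t ≠ 0) :
    IntegrableOn (logNormZeta t) (Set.Ioi 0) := by
  rw [← Set.Ioc_union_Ioi_eq_Ioi (show (0 : ℝ) ≤ 2 by norm_num)]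
  exact integrableOn_union.2
    ⟨(intervalIntegrable_iff_integrableOn_Ioc_of_le (by norm_num)).1
      (intervalIntegrable_logNormZeta ht 0 2), integrableOn_logNormZeta_Ioi_two t⟩

theorem integral_logNormZeta_Ioi_zero {t : ℝ} (ht : t ≠ 0) :
    ∫ s in Set.Ioi 0, logNormZeta t s =
      (∫ s in (0 : ℝ)..2, logNormZeta t s) + ∫ s in Set.Ioi 2, logNormZeta t s := by
  rw [intervalIntegral.integral_of_le (by norm_num),
    ← Set.Ioc_union_Ioi_eq_Ioi (show (0 : ℝ) ≤ 2 by norm_num)]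
  exact setIntegral_union Set.Ioc_disjoint_Ioi_same measurableSet_Ioi
    ((intervalIntegrable_iff_integrableOn_Ioc_of_le (by norm_num)).1
      (intervalIntegrable_logNormZeta ht 0 2)) (integrableOn_logNormZeta_Ioi_two t)

theorem measurePreserving_sub_half_Ioi :
    MeasurePreserving (fun σ : ℝ => σ - 1 / 2) (volume.restrict (Set.Ioi (1 / 2)))
      (volume.restrict (Set.Ioi 0)) := by
  have h := (measurePreserving_sub_right (volume : Measure ℝ) (1 / 2)).restrict_preimage
    (measurableSet_Ioi (a := (0 : ℝ)))
  convert! h using 2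
  ext x
  simp

theorem integral_S_Ioc_one (hRH : RiemannHypothesis) {t : ℝ} (ht : 1 ≤ t) :
    ∫ u in Set.Ioc 1 t, S u =
      1 / π * ((∫ s in Set.Ioi 0, logNormZeta t s) - ∫ s in Set.Ioi 0, logNormZeta 1 s) := by
  have hi : Integrable (Function.uncurry fun σ u : ℝ =>
      (logDeriv riemannZeta (σ + u * Complex.I)).im)
      ((volume.restrict (Set.Ioi (1 / 2 : ℝ))).prod (volume.restrict (Set.Ioc 1 t))) := by
    rw [Measure.prod_restrict]
    exact (integrableOn_logDeriv_riemannZeta_strip (b := 1 / 2) (t := t) one_pos).im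
  have hsw := integral_integral_swap hi
  have hS : ∀ u, S u = -(1 / π) * ∫ σ in Set.Ioi (1 / 2 : ℝ),
      (logDeriv riemannZeta (σ + u * Complex.I)).im := fun u => rfl
  simp_rw [hS]
  rw [integral_const_mul, ← hsw]
  have e : ∫ σ in Set.Ioi (1 / 2 : ℝ), ∫ u in Set.Ioc 1 t,
      (logDeriv riemannZeta (σ + u * Complex.I)).im =
      ∫ σ in Set.Ioi (1 / 2 : ℝ), (logNormZeta 1 (σ - 1 / 2) - logNormZeta t (σ - 1 / 2)) :=
    setIntegral_congr_fun measurableSet_Ioi fun σ hσ =>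
      integral_im_logDeriv_riemannZeta hRH hσ one_pos ht
  have he : MeasurableEmbedding fun σ : ℝ => σ - 1 / 2 := measurableEmbedding_subRight _
  rw [e, measurePreserving_sub_half_Ioi.integral_comp he
      (fun s => logNormZeta 1 s - logNormZeta t s),
    integral_sub (integrableOn_logNormZeta_Ioi_zero one_ne_zero)
      (integrableOn_logNormZeta_Ioi_zero (by positivity))]
  ring

theorem exists_abs_S₁_sub_le (hRH : RiemannHypothesis) :
    ∃ K, ∀ t ≥ 1, IntervalIntegrable S volume 0 t →
      |S₁ t - 1 / π * ∫ s in (0 : ℝ)..2, logNormZeta t s| ≤ K := by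
  refine ⟨|S₁ 1 - 1 / π * ∫ s in Set.Ioi 0, logNormZeta 1 s| +
    1 / π * ∫ s in Set.Ioi 2, 2 * Real.exp 2 * Real.exp (-Real.log 2 * s), fun t ht hi => ?_⟩
  have ht0 : t ≠ 0 := by positivity
  have h01 : IntervalIntegrable S volume 0 1 :=
    hi.mono_set (Set.uIcc_subset_uIcc_left (by
      rw [Set.uIcc_of_le (by linarith)]; constructor <;> linarith))
  have h1t : IntervalIntegrable S volume 1 t := h01.symm.trans hi
  have e : S₁ t = S₁ 1 + ∫ u in Set.Ioc 1 t, S u := by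
    rw [← intervalIntegral.integral_of_le ht]
    exact (intervalIntegral.integral_add_adjacent_intervals h01 h1t).symm
  rw [e, integral_S_Ioc_one hRH ht, integral_logNormZeta_Ioi_zero ht0]
  have h := mul_le_mul_of_nonneg_left (abs_integral_logNormZeta_Ioi_two_le t)
    (by positivity : 0 ≤ 1 / π)
  calc _ = |(S₁ 1 - 1 / π * ∫ s in Set.Ioi 0, logNormZeta 1 s) +
        1 / π * ∫ s in Set.Ioi 2, logNormZeta t s| := by congr 1; ring
    _ ≤ _ := (abs_add_le _ _).trans (by
      rw [abs_mul (1 / π), abs_of_nonneg (by positivity : 0 ≤ 1 / π)]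
      linarith)

theorem one_div_sq_two_mul_sub_le {x y : ℝ} (hx : 0 < x) (hy : 0 ≤ y) (hyx : 8 * y ≤ x) :
    1 / (2 * x - 8 * y) ^ 2 ≤ 1 / (4 * x ^ 2) + 6 * y / x ^ 3 := by
  have hX : x ≤ 2 * x - 8 * y := by linarith
  have e : 1 / (4 * x ^ 2) + 6 * y / x ^ 3 = (x + 24 * y) / (4 * x ^ 3) := by field_simp; ring
  have hX0 : 0 < 2 * x - 8 * y := by linarith
  rw [e, div_le_div_iff₀ (by positivity) (by positivity)]
  have h : 0 ≤ y * ((x - 8 * y) * (x - 3 * y)) :=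
    mul_nonneg hy (mul_nonneg (by linarith) (by linarith))
  nlinarith

theorem truncationError_exp_eq (X : ℝ) :
    truncationError (Real.exp X) = 4 * (Real.exp (X / 2) * X) + 2 * Real.exp (X / 2) + 4 := by
  rw [truncationError, Real.log_exp, Real.exp_half]

section Asymptotics

variable {L : ℝ}

theorem one_le_mul_log_log_div (hl : 1 ≤ Real.log (Real.log L)) (hL : Real.log L ^ 3 ≤ L)
    (h8 : 8 * Real.log (Real.log L) ≤ Real.log L) :
    1 ≤ L * Real.log (Real.log L) / Real.log L ^ 3 := by
  have h0 : 0 < Real.log L := by linarith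
  rw [le_div_iff₀ (by positivity), one_mul]
  nlinarith [pow_pos h0 3]

theorem div_log_cube_le (hl : 1 ≤ Real.log (Real.log L)) (hL : Real.log L ^ 3 ≤ L)
    (h8 : 8 * Real.log (Real.log L) ≤ Real.log L) :
    L / Real.log L ^ 3 ≤ L * Real.log (Real.log L) / Real.log L ^ 3 := by
  have h0 : 0 < Real.log L := by linarith
  gcongr
  nlinarith [pow_pos h0 3]

theorem add_six_div_sq_le (hl : 1 ≤ Real.log (Real.log L)) (hL : Real.log L ^ 3 ≤ L)
    (h8 : 8 * Real.log (Real.log L) ≤ Real.log L) :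
    (L + 6) / (2 * Real.log L - 8 * Real.log (Real.log L)) ^ 2 ≤
      L / (4 * Real.log L ^ 2) + 12 * (L * Real.log (Real.log L) / Real.log L ^ 3) := by
  have h0 : 0 < Real.log L := by linarith
  have hE := one_le_mul_log_log_div hl hL h8
  have hL0 : 0 < L := (pow_pos h0 3).trans_le hL
  have h1 := one_div_sq_two_mul_sub_le h0 (by linarith) h8
  have h2 : 1 / (2 * Real.log L - 8 * Real.log (Real.log L)) ^ 2 ≤ 1 := by
    rw [div_le_one (by nlinarith)]
    nlinarith
  have h3 := mul_le_mul_of_nonneg_left h1 hL0.le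
  have e : L * (1 / (4 * Real.log L ^ 2) + 6 * Real.log (Real.log L) / Real.log L ^ 3) =
      L / (4 * Real.log L ^ 2) + 6 * (L * Real.log (Real.log L) / Real.log L ^ 3) := by ring
  rw [e] at h3
  rw [add_div, ← mul_one_div L, ← mul_one_div (6 : ℝ)]
  linarith

theorem truncationError_exp_two_mul_log_sub_le (hl : 1 ≤ Real.log (Real.log L))
    (hL : Real.log L ^ 3 ≤ L) (h8 : 8 * Real.log (Real.log L) ≤ Real.log L) :
    truncationError (Real.exp (2 * Real.log L - 8 * Real.log (Real.log L))) ≤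
      14 * (L * Real.log (Real.log L) / Real.log L ^ 3) := by
  have h0 : 0 < Real.log L := by linarith
  have hL0 : 0 < L := (pow_pos h0 3).trans_le hL
  have hE := one_le_mul_log_log_div hl hL h8
  have hE' := div_log_cube_le hl hL h8
  have e : Real.exp ((2 * Real.log L - 8 * Real.log (Real.log L)) / 2) = L / Real.log L ^ 4 := by
    have e1 : (2 * Real.log L - 8 * Real.log (Real.log L)) / 2 =
        Real.log L - (4 : ℕ) * Real.log (Real.log L) := by push_cast; ring
    rw [e1, Real.exp_sub, Real.exp_nat_mul, Real.exp_log hL0, Real.exp_log h0]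
  rw [truncationError_exp_eq, e]
  have h1 : L / Real.log L ^ 4 * (2 * Real.log L - 8 * Real.log (Real.log L)) ≤
      2 * (L / Real.log L ^ 3) := by
    calc _ ≤ L / Real.log L ^ 4 * (2 * Real.log L) := by gcongr; linarith
      _ = _ := by field_simp
  have h2 : L / Real.log L ^ 4 ≤ L / Real.log L ^ 3 := by
    gcongr
    · linarith
    · norm_num
  linarith

theorem add_six_mul_log_div_cube_le (hl : 1 ≤ Real.log (Real.log L))
    (hL : Real.log L ^ 3 ≤ L) (h8 : 8 * Real.log (Real.log L) ≤ Real.log L) :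
    (L + 6) * (Real.log (2 * (2 * Real.log L - 8 * Real.log (Real.log L))) + 3) /
      (2 * Real.log L - 8 * Real.log (Real.log L)) ^ 3 ≤
      12 * (L * Real.log (Real.log L) / Real.log L ^ 3) := by
  have h0 : 0 < Real.log L := by linarith
  have hL6 : 6 ≤ L := by
    have : (8 : ℝ) ^ 3 ≤ Real.log L ^ 3 := by gcongr; linarith
    linarith
  have h1 : Real.log (2 * (2 * Real.log L - 8 * Real.log (Real.log L))) ≤
      2 + Real.log (Real.log L) := by
    calc _ ≤ Real.log (4 * Real.log L) := Real.log_le_log (by linarith) (by linarith)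
      _ = Real.log (2 ^ 2) + Real.log (Real.log L) := by
        rw [Real.log_mul (by norm_num) h0.ne']; norm_num
      _ ≤ _ := by rw [Real.log_pow]; push_cast; linarith [Real.log_two_lt_d9]
  have h2 : 0 ≤ Real.log (2 * (2 * Real.log L - 8 * Real.log (Real.log L))) :=
    Real.log_nonneg (by linarith)
  calc _ ≤ (L + L) * (6 * Real.log (Real.log L)) / Real.log L ^ 3 := by
        gcongr <;> linarith
    _ = _ := by ring

end Asymptotics

theorem eventually_log_log_conditions : ∃ t₀ : ℝ, 1 ≤ t₀ ∧ ∀ t ≥ t₀,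
    1 ≤ Real.log (Real.log (Real.log t)) ∧ Real.log (Real.log t) ^ 3 ≤ Real.log t ∧
      8 * Real.log (Real.log (Real.log t)) ≤ Real.log (Real.log t) := by
  have h1 : Filter.Tendsto (fun t => Real.log (Real.log t)) Filter.atTop Filter.atTop :=
    Real.tendsto_log_atTop.comp Real.tendsto_log_atTop
  have h2 : Filter.Tendsto (fun t => Real.log (Real.log (Real.log t))) Filter.atTop Filter.atTop :=
    Real.tendsto_log_atTop.comp h1
  have h3 : ∀ᶠ x : ℝ in Filter.atTop, Real.log x ^ 3 ≤ x := by
    filter_upwards [(Real.isLittleO_pow_log_id_atTop (n := 3)).bound one_pos,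
      Filter.eventually_ge_atTop 1] with x hx hx1
    rw [Real.norm_eq_abs, one_mul, id, Real.norm_eq_abs, abs_of_nonneg (by linarith : 0 ≤ x)] at hx
    exact (le_abs_self _).trans hx
  have h4 : ∀ᶠ x : ℝ in Filter.atTop, 8 * Real.log x ≤ x := by
    filter_upwards [Real.isLittleO_log_id_atTop.bound (by norm_num : (0 : ℝ) < 1 / 8),
      Filter.eventually_ge_atTop 1] with x hx hx1
    rw [Real.norm_eq_abs, id, Real.norm_eq_abs, abs_of_nonneg (by linarith : 0 ≤ x)] at hx
    linarith [le_abs_self (Real.log x)]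
  obtain ⟨t₀, ht₀⟩ := Filter.eventually_atTop.1 ((h2.eventually_ge_atTop 1).and
    ((Real.tendsto_log_atTop.eventually h3).and (h1.eventually h4)))
  exact ⟨max t₀ 1, le_max_right _ _, fun t ht => ht₀ t ((le_max_left _ _).trans ht)⟩

theorem S₁_bounds (hRH : RiemannHypothesis) :
    ∃ C > 0, ∃ t₀ : ℝ, ∀ t ≥ t₀,
      -(π / 24) * Real.log t / (Real.log (Real.log t)) ^ 2 -
          C * (Real.log t * Real.log (Real.log (Real.log t))) / (Real.log (Real.log t)) ^ 3
        ≤ S₁ t ∧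
      S₁ t ≤ (π / 48) * Real.log t / (Real.log (Real.log t)) ^ 2 +
          C * (Real.log t * Real.log (Real.log (Real.log t))) / (Real.log (Real.log t)) ^ 3 := by
  obtain ⟨K, hK⟩ := exists_abs_S₁_sub_le hRH
  obtain ⟨t₀, ht₀, hlog⟩ := eventually_log_log_conditions
  refine ⟨|K| + 400, by positivity, t₀, fun t ht => ?_⟩
  obtain ⟨hl, hL, h8⟩ := hlog t ht
  have ht1 : 1 ≤ t := ht₀.trans ht
  have hE := one_le_mul_log_log_div hl hL h8
  have hsq := add_six_div_sq_le hl hL h8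
  have hT := truncationError_exp_two_mul_log_sub_le hl hL h8
  have hcube := add_six_mul_log_div_cube_le hl hL h8
  have hX : 1 ≤ 2 * Real.log (Real.log t) - 8 * Real.log (Real.log (Real.log t)) := by linarith
  have hup := integral_logNormZeta_le hRH ht1 (zero_lt_one.trans_le hX)
  have hlo := le_integral_logNormZeta hRH ht1 hX
  have hL0 : 0 ≤ Real.log t := Real.log_nonneg ht1
  have hM0 : 0 ≤ Real.log t / Real.log (Real.log t) ^ 2 := by positivity
  set X := 2 * Real.log (Real.log t) - 8 * Real.log (Real.log (Real.log t))
  have eM : Real.log t / (4 * Real.log (Real.log t) ^ 2) =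
      Real.log t / Real.log (Real.log t) ^ 2 / 4 := by ring
  have e1 : (Real.log t + 6) * (π ^ 2 / 12) / X ^ 2 =
      π * (π / 12 * ((Real.log t + 6) / X ^ 2)) := by ring
  have e2 : (Real.log t + 6) * (π ^ 2 / 6) / X ^ 2 =
      π * (π / 6 * ((Real.log t + 6) / X ^ 2)) := by ring
  rw [e1] at hup
  rw [e2] at hlo
  rw [eM] at hsq
  rw [mul_div_assoc (|K| + 400), mul_div_assoc (-(π / 24)), mul_div_assoc (π / 48)]
  set E := Real.log t * Real.log (Real.log (Real.log t)) / Real.log (Real.log t) ^ 3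
  set M := Real.log t / Real.log (Real.log t) ^ 2
  set Q := (Real.log t + 6) / X ^ 2
  set I := ∫ s in (0 : ℝ)..2, logNormZeta t s
  have hpi := Real.pi_gt_three
  have hpi4 := Real.pi_le_four
  have hKE : |K| ≤ |K| * E := le_mul_of_one_le_right (abs_nonneg K) hE
  by_cases hi : IntervalIntegrable S volume 0 t
  · have h : -|K| ≤ S₁ t - 1 / π * I ∧ S₁ t - 1 / π * I ≤ |K| :=
      abs_le.1 ((hK t ht1 hi).trans (le_abs_self K))
    have hup' : 1 / π * I ≤ π / 12 * (M / 4 + 12 * E) + 64 * E := by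
      rw [one_div, inv_mul_le_iff₀ Real.pi_pos]
      have := mul_le_mul_of_nonneg_left hsq (by positivity : 0 ≤ π * (π / 12))
      nlinarith
    have hlo' : -(π / 6 * (M / 4 + 12 * E) + 389 * E) ≤ 1 / π * I := by
      rw [one_div, le_inv_mul_iff₀ Real.pi_pos]
      have := mul_le_mul_of_nonneg_left hsq (by positivity : 0 ≤ π * (π / 6))
      nlinarith
    constructor <;> nlinarith
  · have h0 : S₁ t = 0 := intervalIntegral.integral_undef hi
    rw [h0]
    constructor
    · have : 0 ≤ π / 24 * M := by positivity
      nlinarith [abs_nonneg K]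
    · positivity
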